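/- Let Φ be a contractive Schur idempotent on B(H) and U ⊆ B(H) a hyperreflexive weak* closed masa-bimodule. Then the algebraic sum W = U + ran(id − Φ) is hyperreflexive and k(W) ≤ k(U). -/

import Mathlib

open scoped InnerProductSpace Pointwise

noncomputable section

namespace SchurHyper

/-- `B H` is the algebra of bounded linear operators on `H`. -/
abbrev B (H : Type*) [NormedAddCommGroup H] [InnerProductSpace ℂ H] : Type _ := H →L[ℂ] H

variable (H : Type*) [NormedAddCommGroup H] [InnerProductSpace ℂ H]

/-- A linear functional on `B H` is *normal* (weak* continuous) if it arises from
the duality with the trace class, i.e. it is of the form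
`T ↦ ∑ₙ ⟪yₙ, T xₙ⟫` for square-summable sequences `(xₙ)`, `(yₙ)`
(recall that the inner product is conjugate-linear in its first slot). -/
def IsNormalFunctional (ω : B H →ₗ[ℂ] ℂ) : Prop :=
  ∃ x y : ℕ → H, Summable (fun n => ‖x n‖ ^ 2) ∧ Summable (fun n => ‖y n‖ ^ 2) ∧
    ∀ T : B H, ω T = ∑' n, ⟪y n, T (x n)⟫_ℂ

/-- The weak* topology on `B H`: the topology induced by the normal functionals. -/
def weakStarTopology : TopologicalSpace (B H) :=
  TopologicalSpace.induced
    (fun (T : B H) (ω : {ω : B H →ₗ[ℂ] ℂ // IsNormalFunctional H ω}) => ω.1 T)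
    inferInstance

/-- A set of operators is weak* closed if it is closed in the weak* topology. -/
def WStarClosed (X : Set (B H)) : Prop := @IsClosed _ (weakStarTopology H) X

/-- The weak* closure of a set of operators. -/
def wStarClosure (X : Set (B H)) : Set (B H) := @closure _ (weakStarTopology H) X

/-- A map on `B H` is weak* continuous if it is continuous with respect to the
weak* topology on both sides. -/
def WStarContinuous (Φ : B H →L[ℂ] B H) : Prop :=
  @Continuous _ _ (weakStarTopology H) (weakStarTopology H) Φ

variable {H}
variable [CompleteSpace H]

/-- A maximal abelian selfadjoint subalgebra of `B H`: an abelian selfadjoint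
subalgebra which contains every operator commuting with it (equivalently, it
coincides with its own commutant). -/
def IsMasa (D : StarSubalgebra ℂ (B H)) : Prop :=
  (∀ A ∈ D, ∀ C ∈ D, A * C = C * A) ∧
  (∀ T : B H, (∀ A ∈ D, T * A = A * T) → T ∈ D)

/-- A Schur multiplier: a weak* continuous `D`-bimodule map on `B H`. -/
def IsSchurMultiplier (D : StarSubalgebra ℂ (B H)) (Φ : B H →L[ℂ] B H) : Prop :=
  WStarContinuous H Φ ∧ ∀ A ∈ D, ∀ C ∈ D, ∀ T : B H, Φ (A * T * C) = A * Φ T * C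

/-- A Schur idempotent: an idempotent Schur multiplier. -/
def IsSchurIdempotent (D : StarSubalgebra ℂ (B H)) (Φ : B H →L[ℂ] B H) : Prop :=
  IsSchurMultiplier D Φ ∧ Φ.comp Φ = Φ

/-- A subspace `X ⊆ B H` is a `D`-bimodule if `D X D ⊆ X`. -/
def IsBimodule (D : StarSubalgebra ℂ (B H)) (X : Submodule ℂ (B H)) : Prop :=
  ∀ A ∈ D, ∀ C ∈ D, ∀ T ∈ X, A * T * C ∈ X

/-- The Arveson distance `α(T, X)`. -/
def arveson (T : B H) (X : Set (B H)) : ℝ :=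
  ⨆ ξ : {ξ : H // ‖ξ‖ = 1}, ⨅ S : X, ‖T ξ.1 - S.1 ξ.1‖

/-- The set of hyperreflexivity constants of `X`. -/
def hyperSet (X : Set (B H)) : Set ℝ :=
  {k | 0 < k ∧ ∀ T : B H, Metric.infDist T X ≤ k * arveson T X}

/-- A subspace is hyperreflexive if `d(T, X) ≤ k ⬝ α(T, X)` for some `k > 0`. -/
def Hyperreflexive (X : Set (B H)) : Prop := (hyperSet X).Nonempty

/-- The hyperreflexivity constant `k(X)`: the least constant that works. -/
def hyperConst (X : Set (B H)) : ℝ := sInf (hyperSet X)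

/-- The set of constants `λ` witnessing that a Schur idempotent lies in `𝔉H`. -/
def lamSet (Φ : B H →L[ℂ] B H) : Set ℝ :=
  {l | 0 < l ∧ ∀ T : B H, ‖T - Φ T‖ ≤ l * arveson T (Set.range Φ)}

/-- The class `𝔉H` of Schur idempotents `Φ` such that
`‖T - Φ T‖ ≤ λ ⬝ α(T, ran Φ)` for some `λ > 0` and all `T`. -/
def MemFH (D : StarSubalgebra ℂ (B H)) (Φ : B H →L[ℂ] B H) : Prop :=
  IsSchurIdempotent D Φ ∧ (lamSet Φ).Nonempty

/-- The constant `λ(Φ)`: the least constant witnessing membership of `𝔉H`. -/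
def lam (Φ : B H →L[ℂ] B H) : ℝ := sInf (lamSet Φ)

/-- A ternary masa-bimodule condition: `S T* R ∈ M` whenever `S, T, R ∈ M`. -/
def IsTernary (M : Submodule ℂ (B H)) : Prop :=
  ∀ S ∈ M, ∀ T ∈ M, ∀ R ∈ M, S * star T * R ∈ M

end SchurHyper

open SchurHyper

namespace SchurHyper

variable {H : Type*} [NormedAddCommGroup H] [InnerProductSpace ℂ H]

/-- The Hilbert sum of copies of `H` indexed by `ι`. -/
abbrev HSum (ι : Type) (H : Type*) [NormedAddCommGroup H] : Type _ := lp (fun _ : ι => H) 2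

omit [InnerProductSpace ℂ H] in
theorem memℓp_two_iff {ι : Type} {x : ι → H} :
    Memℓp x 2 ↔ Summable fun i => ‖x i‖ ^ 2 := by
  rw [memℓp_gen_iff (by norm_num)]
  norm_num

omit [InnerProductSpace ℂ H] in
theorem HSum.norm_sq {ι : Type} (x : HSum ι H) : ‖x‖ ^ 2 = ∑' i, ‖x i‖ ^ 2 := by
  have := lp.norm_rpow_eq_tsum (p := 2) (by norm_num) x
  norm_num at this
  exact this

omit [InnerProductSpace ℂ H] in
theorem HSum.summable_sq {ι : Type} (x : HSum ι H) : Summable fun i => ‖x i‖ ^ 2 :=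
  memℓp_two_iff.1 (lp.memℓp x)

theorem norm_apply_sq_le (T : B H) (v : H) : ‖T v‖ ^ 2 ≤ ‖T‖ ^ 2 * ‖v‖ ^ 2 := by
  rw [← mul_pow]
  gcongr
  exact T.le_opNorm v

/-- The diagonal action of an operator on a Hilbert sum of copies of `H`. -/
def amp (ι : Type) (T : B H) : HSum ι H →L[ℂ] HSum ι H :=
  LinearMap.mkContinuous
    { toFun := fun x => ⟨fun i => T (x i), memℓp_two_iff.2
        (((HSum.summable_sq x).mul_left (‖T‖ ^ 2)).of_nonneg_of_le (fun _ => by positivity)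
          fun i => norm_apply_sq_le T (x i))⟩
      map_add' := fun x y => by ext i; exact map_add T _ _
      map_smul' := fun c x => by ext i; simp } ‖T‖ <| fun x => by
    refine le_of_sq_le_sq ?_ (by positivity)
    rw [mul_pow, HSum.norm_sq, HSum.norm_sq, ← tsum_mul_left]
    refine Summable.tsum_le_tsum (fun i => norm_apply_sq_le T (x i)) ?_
      ((HSum.summable_sq x).mul_left (‖T‖ ^ 2))
    exact ((HSum.summable_sq x).mul_left (‖T‖ ^ 2)).of_nonneg_of_le (fun _ => by positivity)
      fun i => norm_apply_sq_le T (x i)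

@[simp] theorem amp_apply {ι : Type} (T : B H) (x : HSum ι H) (i : ι) :
    amp ι T x i = T (x i) := rfl

theorem norm_amp_le (ι : Type) (T : B H) : ‖amp ι T‖ ≤ ‖T‖ :=
  LinearMap.mkContinuous_norm_le _ (norm_nonneg _) _

theorem amp_mul {ι : Type} (S T : B H) : amp ι (S * T) = amp ι S * amp ι T := by
  ext x i; simp

variable [CompleteSpace H]

theorem star_amp {ι : Type} (T : B H) : star (amp ι T) = amp ι (star T) := by
  refine ContinuousLinearMap.ext fun x => ext_inner_left ℂ fun y => ?_
  rw [ContinuousLinearMap.star_eq_adjoint, ContinuousLinearMap.adjoint_inner_right,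
    lp.inner_eq_tsum, lp.inner_eq_tsum]
  refine tsum_congr fun i => ?_
  rw [amp_apply, amp_apply, ContinuousLinearMap.star_eq_adjoint,
    ContinuousLinearMap.adjoint_inner_right]

/-- The functional `ω` is given by a pair of vectors in a Hilbert sum of copies of `H`. -/
def Spatial (ω : B H →ₗ[ℂ] ℂ) : Prop :=
  ∃ (ι : Type) (x y : HSum ι H), ∀ T, ω T = ⟪y, amp ι T x⟫_ℂ

omit [CompleteSpace H] in
theorem IsNormalFunctional.spatial {ω : B H →ₗ[ℂ] ℂ} (h : IsNormalFunctional H ω) :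
    Spatial ω := by
  obtain ⟨x, y, hx, hy, hω⟩ := h
  exact ⟨ℕ, ⟨x, memℓp_two_iff.2 hx⟩, ⟨y, memℓp_two_iff.2 hy⟩, fun T => by
    rw [hω, lp.inner_eq_tsum]; rfl⟩

omit [InnerProductSpace ℂ H] [CompleteSpace H] in
theorem exists_hSum_sumElim {ι κ : Type} (x : HSum ι H) (x' : HSum κ H) :
    ∃ z : HSum (ι ⊕ κ) H, (∀ i, z (Sum.inl i) = x i) ∧ ∀ k, z (Sum.inr k) = x' k := by
  refine ⟨⟨Sum.elim x x', memℓp_two_iff.2 ?_⟩, fun _ => rfl, fun _ => rfl⟩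
  have h1 := (HSum.summable_sq x).hasSum
  have h2 := (HSum.summable_sq x').hasSum
  exact (HasSum.sum (f := fun i => ‖Sum.elim (⇑x) (⇑x') i‖ ^ 2) h1 h2).summable

omit [CompleteSpace H] in
theorem inner_amp_sum {ι κ : Type} (z w : HSum (ι ⊕ κ) H) (x y : HSum ι H) (x' y' : HSum κ H)
    (hz : ∀ i, z (Sum.inl i) = x i) (hz' : ∀ k, z (Sum.inr k) = x' k)
    (hw : ∀ i, w (Sum.inl i) = y i) (hw' : ∀ k, w (Sum.inr k) = y' k) (T : B H) :
    ⟪w, amp _ T z⟫_ℂ = ⟪y, amp _ T x⟫_ℂ + ⟪y', amp _ T x'⟫_ℂ := by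
  refine (lp.hasSum_inner w (amp _ T z)).unique (HasSum.sum ?_ ?_)
  · convert lp.hasSum_inner y (amp _ T x) using 2
    simp [hz, hw]
  · convert lp.hasSum_inner y' (amp _ T x') using 2
    simp [hz', hw']

omit [CompleteSpace H] in
theorem spatial_of_mem_span {ω : B H →ₗ[ℂ] ℂ}
    (h : ω ∈ Submodule.span ℂ {ω : B H →ₗ[ℂ] ℂ | IsNormalFunctional H ω}) : Spatial ω := by
  induction h using Submodule.span_induction with
  | mem ω h => exact IsNormalFunctional.spatial h
  | zero => exact ⟨ℕ, 0, 0, fun T => by simp⟩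
  | add ω ω' _ _ h h' =>
    obtain ⟨ι, x, y, hω⟩ := h
    obtain ⟨κ, x', y', hω'⟩ := h'
    obtain ⟨z, hz, hz'⟩ := exists_hSum_sumElim x x'
    obtain ⟨w, hw, hw'⟩ := exists_hSum_sumElim y y'
    exact ⟨ι ⊕ κ, z, w, fun T => by
      rw [inner_amp_sum z w x y x' y' hz hz' hw hw', LinearMap.add_apply, hω, hω']⟩
  | smul c ω _ h =>
    obtain ⟨ι, x, y, hω⟩ := h
    exact ⟨ι, c • x, y, fun T => by
      rw [map_smul, inner_smul_right, LinearMap.smul_apply, hω, smul_eq_mul]⟩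

omit [CompleteSpace H] in
theorem isNormalFunctional_vector (ξ η : H) :
    IsNormalFunctional H
      ((innerSL ℂ η).toLinearMap ∘ₗ (ContinuousLinearMap.apply ℂ H ξ).toLinearMap) := by
  refine ⟨fun n => if n = 0 then ξ else 0, fun n => if n = 0 then η else 0,
    summable_of_ne_finset_zero (s := {0}) fun n hn => ?_,
    summable_of_ne_finset_zero (s := {0}) fun n hn => ?_, fun T => ?_⟩
  · simp only [Finset.mem_singleton] at hn
    simp [hn]
  · simp only [Finset.mem_singleton] at hn
    simp [hn]
  · rw [tsum_eq_single 0 fun n hn => by simp [hn]]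
    simp

omit [CompleteSpace H] in
/-- Vector functionals composed with a weak* continuous map, shifted by the vector functional
itself, are spatial with a distinguished coordinate. -/
theorem exists_spatial_add (Φ : B H →L[ℂ] B H) (hΦ : WStarContinuous H Φ) (ξ η : H) :
    ∃ (ι : Type) (i : ι) (x y : HSum ι H), x i = ξ ∧ y i = η ∧
      ∀ T, ⟪η, Φ T ξ + T ξ⟫_ℂ = ⟪y, amp ι T x⟫_ℂ := by
  set ω : B H →ₗ[ℂ] ℂ :=
    ((innerSL ℂ η).toLinearMap ∘ₗ (ContinuousLinearMap.apply ℂ H ξ).toLinearMap) with hω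
  have hspan : ω ∘ₗ Φ.toLinearMap ∈
      Submodule.span ℂ {ω : B H →ₗ[ℂ] ℂ | IsNormalFunctional H ω} := by
    have := (LinearMap.mem_span_iff_continuous
      (f := fun ω : {ω : B H →ₗ[ℂ] ℂ // IsNormalFunctional H ω} => ω.1)
      (ω ∘ₗ Φ.toLinearMap)).2 ?_
    · simpa using this
    · have h1 : @Continuous _ _ (weakStarTopology H) _ fun T : B H => ω T := by
        have h2 : @Continuous _ _ (weakStarTopology H) _
            (fun (T : B H) (ω : {ω : B H →ₗ[ℂ] ℂ // IsNormalFunctional H ω}) => ω.1 T) :=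
          continuous_induced_dom
        exact @Continuous.comp _ _ _ (weakStarTopology H) _ _ _
          (fun p : {ω : B H →ₗ[ℂ] ℂ // IsNormalFunctional H ω} → ℂ =>
            p ⟨ω, isNormalFunctional_vector ξ η⟩) (continuous_apply _) h2
      have h3 := @Continuous.comp _ _ _ (weakStarTopology H) (weakStarTopology H) _ _ _ h1 hΦ
      rwa [weakStarTopology, induced_to_pi] at h3
  obtain ⟨κ, x, y, hxy⟩ := spatial_of_mem_span hspan
  obtain ⟨z, hz, hz'⟩ := exists_hSum_sumElim x
    (⟨fun _ => ξ, memℓp_two_iff.2 (Summable.of_finite)⟩ : HSum Unit H)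
  obtain ⟨w, hw, hw'⟩ := exists_hSum_sumElim y
    (⟨fun _ => η, memℓp_two_iff.2 (Summable.of_finite)⟩ : HSum Unit H)
  refine ⟨κ ⊕ Unit, Sum.inr (), z, w, hz' (), hw' (), fun T => ?_⟩
  rw [inner_amp_sum z w x y _ _ hz hz' hw hw', ← hxy, inner_add_right, lp.inner_eq_tsum]
  simp [hω]

end SchurHyper

namespace SchurHyper

variable {H : Type*} [NormedAddCommGroup H] [InnerProductSpace ℂ H] [CompleteSpace H]
variable {D : StarSubalgebra ℂ (B H)}

theorem IsMasa.mem_of_commute (hD : IsMasa D) {T : B H} (h : ∀ A ∈ D, Commute A T) : T ∈ D :=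
  hD.2 T fun A hA => (h A hA).eq.symm

theorem IsMasa.posPart_mem (hD : IsMasa D) {G : B H} (hG : G ∈ D) : G⁺ ∈ D := by
  refine hD.mem_of_commute fun A hA => ?_
  rw [CFC.posPart_def]
  exact (Commute.cfcₙ_real (hD.1 G hG A hA) _).symm

theorem IsMasa.negPart_mem (hD : IsMasa D) {G : B H} (hG : G ∈ D) : G⁻ ∈ D := by
  refine hD.mem_of_commute fun A hA => ?_
  rw [CFC.negPart_def]
  exact (Commute.cfcₙ_real (hD.1 G hG A hA) _).symm

omit [CompleteSpace H] in
theorem re_inner_nonneg {G : B H} (hG : 0 ≤ G) (v : H) : 0 ≤ (⟪G v, v⟫_ℂ).re :=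
  ((ContinuousLinearMap.nonneg_iff_isPositive G).1 hG).re_inner_nonneg_left v

theorem mul_posPart {G : B H} (hs : IsSelfAdjoint G) : G * G⁺ = G⁺ * G⁺ := by
  nth_rw 1 [← CFC.posPart_sub_negPart G hs]
  rw [sub_mul, CFC.negPart_mul_posPart, sub_zero]

/-- A selfadjoint element of a masa is nonnegative on the range of its positive part. -/
theorem IsMasa.re_inner_posPart_nonneg (hD : IsMasa D) {G : B H} (hG : G ∈ D)
    (hs : IsSelfAdjoint G) {C : B H} (hC : C ∈ D) (v : H) :
    0 ≤ (⟪G (C (G⁺ v)), C (G⁺ v)⟫_ℂ).re := by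
  have h1 : C * G⁺ = G⁺ * C := hD.1 _ hC _ (hD.posPart_mem hG)
  have h2 : C (G⁺ v) = G⁺ (C v) := congrArg (fun T : B H => T v) h1
  have h3 : G (G⁺ (C v)) = G⁺ (G⁺ (C v)) := congrArg (fun T : B H => T (C v)) (mul_posPart hs)
  rw [h2, h3]
  exact re_inner_nonneg (CFC.posPart_nonneg G) _

theorem posPart_apply_ne_zero {G : B H} (hs : IsSelfAdjoint G) {h : H}
    (hh : 0 < (⟪G h, h⟫_ℂ).re) : G⁺ h ≠ 0 := by
  intro h0
  have h1 : G h = G⁺ h - G⁻ h := by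
    conv_lhs => rw [← CFC.posPart_sub_negPart G hs]
    rfl
  rw [h1, h0, zero_sub, inner_neg_left, Complex.neg_re] at hh
  linarith [re_inner_nonneg (CFC.negPart_nonneg G) h]

/-- Functional calculus localises the positivity of a quadratic form in a masa. -/
theorem IsMasa.exists_nonneg_on (hD : IsMasa D) {G : B H} (hG : G ∈ D) (hs : IsSelfAdjoint G)
    {h : H} (hh : 0 < (⟪G h, h⟫_ℂ).re) :
    ∃ f ∈ D, f h ≠ 0 ∧ ∀ C ∈ D, 0 ≤ (⟪G (C (f h)), C (f h)⟫_ℂ).re :=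
  ⟨G⁺, hD.posPart_mem hG, posPart_apply_ne_zero hs hh,
    fun _ hC => hD.re_inner_posPart_nonneg hG hs hC h⟩

theorem isUnit_smul_one_add {P : B H} (hP : 0 ≤ P) {a : ℝ} (ha : 0 < a) :
    IsUnit ((a : ℂ) • (1 : B H) + P) := by
  have h1 : IsStrictlyPositive ((a : ℂ) • (1 : B H)) := by
    rw [Complex.coe_smul]
    refine IsStrictlyPositive.iff_of_unital.2 ⟨smul_nonneg ha.le zero_le_one, ?_⟩
    rw [← Algebra.algebraMap_eq_smul_one]
    exact (IsUnit.mk0 a ha.ne').map (algebraMap ℝ (B H))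
  exact (h1.add_nonneg hP).isUnit

theorem smul_one_mem (D : StarSubalgebra ℂ (B H)) (c : ℂ) : c • (1 : B H) ∈ D :=
  D.smul_mem (one_mem D) c

/-- A module map from an invariant subspace of an amplification onto part of `H` has a local
right inverse intertwining the actions of a masa. -/
theorem IsMasa.exists_intertwiner (hD : IsMasa D) {E : Type*} [NormedAddCommGroup E]
    [InnerProductSpace ℂ E] [CompleteSpace E] (ρ : B H → E →L[ℂ] E)
    (hρ : ∀ T, star (ρ T) = ρ (star T)) (L : Submodule ℂ E) (hL : IsClosed (L : Set E))
    (hLD : ∀ A ∈ D, ∀ v ∈ L, ρ A v ∈ L) (X : E →L[ℂ] H)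
    (hX : ∀ A ∈ D, ∀ v, X (ρ A v) = A (X v)) {m : E} (hm : m ∈ L) (hXm : X m ≠ 0) :
    ∃ V : H →L[ℂ] E, (∀ u, V u ∈ L) ∧ (∀ A ∈ D, ∀ u, V (A u) = ρ A (V u)) ∧
      ∃ h, h ≠ 0 ∧ X (V h) = h := by
  have : CompleteSpace L := hL.completeSpace_coe
  set Y : H →L[ℂ] E := L.subtypeL ∘L ContinuousLinearMap.adjoint (X ∘L L.subtypeL) with hY
  have hYL : ∀ u, Y u ∈ L := fun u => (ContinuousLinearMap.adjoint (X ∘L L.subtypeL) u).2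
  have hYi : ∀ v ∈ L, ∀ u, ⟪v, Y u⟫_ℂ = ⟪X v, u⟫_ℂ := fun v hv u => by
    have := ContinuousLinearMap.adjoint_inner_right (X ∘L L.subtypeL) ⟨v, hv⟩ u
    simpa [hY] using this
  have hYD : ∀ A ∈ D, ∀ u, Y (A u) = ρ A (Y u) := fun A hA u => by
    have key : ∀ v ∈ L, ⟪v, Y (A u)⟫_ℂ = ⟪v, ρ A (Y u)⟫_ℂ := fun v hv => by
      have e1 : ρ A = ContinuousLinearMap.adjoint (ρ (star A)) := by
        rw [← hρ, ContinuousLinearMap.star_eq_adjoint, ContinuousLinearMap.adjoint_adjoint]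
      rw [hYi v hv, e1, ContinuousLinearMap.adjoint_inner_right,
        hYi _ (hLD _ (star_mem hA) v hv), hX _ (star_mem hA), ContinuousLinearMap.star_eq_adjoint,
        ContinuousLinearMap.adjoint_inner_left]
    have hd : Y (A u) - ρ A (Y u) ∈ L := L.sub_mem (hYL _) (hLD A hA _ (hYL u))
    have := key _ hd
    rw [← sub_eq_zero, ← inner_sub_right, inner_self_eq_zero, sub_eq_zero] at this
    exact this
  set A0 : B H := X ∘L Y with hA0
  have hA0i : ∀ u w, ⟪A0 u, w⟫_ℂ = ⟪Y u, Y w⟫_ℂ := fun u w => (hYi _ (hYL u) w).symm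
  have hA0D : A0 ∈ D := hD.mem_of_commute fun A hA => by
    ext u
    change A (X (Y u)) = X (Y (A u))
    rw [hYD A hA, hX A hA]
  have hA0s : IsSelfAdjoint A0 := by
    rw [ContinuousLinearMap.isSelfAdjoint_iff_isSymmetric]
    intro u w
    change ⟪A0 u, w⟫_ℂ = ⟪u, A0 w⟫_ℂ
    rw [hA0i, ← inner_conj_symm u, hA0i, inner_conj_symm]
  set h0 := X m with hh0
  have hY0 : Y h0 ≠ 0 := fun h => hXm <| by
    have := hYi m hm h0
    rw [h, inner_zero_right] at this
    exact inner_self_eq_zero.1 this.symm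
  have hn : 0 < ‖Y h0‖ := norm_pos_iff.2 hY0
  have hn' : 0 < ‖h0‖ := norm_pos_iff.2 hXm
  set a : ℝ := ‖Y h0‖ ^ 2 / (2 * ‖h0‖ ^ 2) with ha
  have ha0 : 0 < a := by positivity
  set G : B H := A0 - (a : ℂ) • (1 : B H) with hG
  have hGD : G ∈ D := sub_mem hA0D (smul_one_mem D _)
  have hGs : IsSelfAdjoint G := by
    refine hA0s.sub ?_
    rw [isSelfAdjoint_iff, star_smul, star_one]
    simp
  have hGpos : 0 < (⟪G h0, h0⟫_ℂ).re := by
    have e : ⟪G h0, h0⟫_ℂ = ⟪Y h0, Y h0⟫_ℂ - (a : ℂ) * ⟪h0, h0⟫_ℂ := by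
      rw [← hA0i, hG]
      simp
    rw [e, inner_self_eq_norm_sq_to_K, inner_self_eq_norm_sq_to_K]
    have : ((‖Y h0‖ : ℂ) ^ 2 - (a : ℂ) * (‖h0‖ : ℂ) ^ 2).re = ‖Y h0‖ ^ 2 - a * ‖h0‖ ^ 2 := by
      norm_cast
    refine lt_of_lt_of_eq ?_ this.symm
    rw [ha]
    field_simp
    nlinarith
  set P : B H := G⁺ with hP
  have hPD : P ∈ D := hD.posPart_mem hGD
  obtain ⟨Z, hZ⟩ := isUnit_smul_one_add (CFC.posPart_nonneg G) ha0
  have hZD : (Z : B H) ∈ D := hZ ▸ add_mem (smul_one_mem D _) hPD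
  have hZi : ∀ A ∈ D, A * (↑Z⁻¹ : B H) = ↑Z⁻¹ * A := fun A hA =>
    (Commute.units_inv_right (show Commute A (Z : B H) from hD.1 A hA _ hZD)).eq
  have hZP : A0 * P = Z * P := by
    have : A0 = G + (a : ℂ) • (1 : B H) := by rw [hG]; abel
    rw [this, hZ, add_mul, add_mul, mul_posPart hGs]
    abel
  refine ⟨Y ∘L (↑Z⁻¹ : B H), fun u => hYL _, fun A hA u => ?_, P h0,
    posPart_apply_ne_zero hGs hGpos, ?_⟩
  · have : (↑Z⁻¹ : B H) (A u) = A ((↑Z⁻¹ : B H) u) :=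
      congrArg (fun T : B H => T u) (hZi A hA).symm
    change Y ((↑Z⁻¹ : B H) (A u)) = _
    rw [this, hYD A hA]
    rfl
  · have : A0 * (↑Z⁻¹ : B H) * P = P := by
      rw [hZi A0 hA0D, mul_assoc, hZP, ← mul_assoc, Units.inv_mul, one_mul]
    exact congrArg (fun T : B H => T h0) this

end SchurHyper

namespace SchurHyper

variable {H : Type*} [NormedAddCommGroup H] [InnerProductSpace ℂ H] [CompleteSpace H]
variable {D : StarSubalgebra ℂ (B H)}

theorem IsMasa.isClosed (hD : IsMasa D) : IsClosed (D : Set (B H)) := by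
  have : (D : Set (B H)) = ⋂ A : D, {T : B H | (A : B H) * T = T * A} := by
    ext T
    simp only [Set.mem_iInter, Set.mem_ofPred_eq]
    exact ⟨fun hT A => hD.1 _ A.2 _ hT, fun h => hD.mem_of_commute fun A hA => h ⟨A, hA⟩⟩
  rw [this]
  exact isClosed_iInter fun A =>
    isClosed_eq (continuous_const.mul continuous_id) (continuous_id.mul continuous_const)

/-- There is a character of the masa that vanishes on the annihilator of a given vector. -/
theorem IsMasa.exists_character (hD : IsMasa D) {h : H} (hh : h ≠ 0) :
    ∃ χ : D →ₐ[ℂ] ℂ, ∀ f : D, (f : B H) h = 0 → χ f = 0 := by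
  let : NormedCommRing D :=
    { (inferInstance : NormedRing D) with
      mul_comm := fun a b => Subtype.ext (hD.1 _ a.2 _ b.2) }
  have : CompleteSpace D := hD.isClosed.completeSpace_coe
  let I : Ideal D :=
    { carrier := {f | (f : B H) h = 0}
      add_mem' := fun {a b} ha hb => by
        simp only [Set.mem_ofPred_eq] at ha hb
        simp [ha, hb]
      zero_mem' := by simp
      smul_mem' := fun c f hf => by
        simp only [Set.mem_ofPred_eq] at hf
        simp [hf] }
  have hI : I ≠ ⊤ := fun h1 => by
    have : (1 : D) ∈ I := h1 ▸ Submodule.mem_top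
    exact hh (by simpa [I] using this)
  obtain ⟨M, hM, hIM⟩ := I.exists_le_maximal hI
  exact ⟨WeakDual.CharacterSpace.equivAlgHom M.toCharacterSpace, fun f hf =>
    M.toCharacterSpace_apply_eq_zero_of_mem (hIM hf)⟩

theorem IsMasa.apply_ne_zero_of_isUnit (hD : IsMasa D) (χ : D →ₐ[ℂ] ℂ) {f : D}
    (hf : IsUnit (f : B H)) : χ f ≠ 0 := by
  obtain ⟨u, hu⟩ := hf
  have hinv : (↑u⁻¹ : B H) ∈ D := hD.mem_of_commute fun A hA =>
    Commute.units_inv_right (hu ▸ hD.1 A hA _ f.2)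
  have : f * ⟨_, hinv⟩ = 1 := Subtype.ext (by simp [← hu])
  intro h0
  have h1 := congrArg χ this
  rw [map_mul, h0, zero_mul, map_one] at h1
  exact zero_ne_one h1

theorem inner_star_mul_self_apply (T : B H) (v : H) :
    (⟪(star T * T) v, v⟫_ℂ).re = ‖T v‖ ^ 2 := by
  rw [ContinuousLinearMap.star_eq_adjoint]
  change (⟪ContinuousLinearMap.adjoint T (T v), v⟫_ℂ).re = _
  rw [ContinuousLinearMap.adjoint_inner_left, inner_self_eq_norm_sq_to_K]
  norm_cast

theorem isSelfAdjoint_smul_one (a : ℝ) : IsSelfAdjoint ((a : ℂ) • (1 : B H)) := by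
  rw [isSelfAdjoint_iff, star_smul, star_one]
  simp

omit [CompleteSpace H] in
theorem re_inner_smul_one_sub (a : ℝ) (K : B H) (v : H) :
    (⟪((a : ℂ) • (1 : B H) - K) v, v⟫_ℂ).re = a * ‖v‖ ^ 2 - (⟪K v, v⟫_ℂ).re := by
  change (⟪(a : ℂ) • v - K v, v⟫_ℂ).re = _
  rw [inner_sub_left, inner_smul_left, Complex.conj_ofReal, inner_self_eq_norm_sq_to_K,
    Complex.sub_re, Complex.re_ofReal_mul]
  congr 2
  norm_cast

/-- Finitely many elements of a masa are simultaneously almost scalar near a given vector. -/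
theorem IsMasa.exists_scalars (hD : IsMasa D) {h : H} (hh : h ≠ 0) {ι : Type*} (s : Finset ι)
    (A : ι → B H) (hA : ∀ i, A i ∈ D) {ε : ℝ} (hε : 0 < ε) :
    ∃ f ∈ D, f h ≠ 0 ∧ ∃ a : ι → ℂ, ∀ C ∈ D,
      ∑ i ∈ s, ‖A i (C (f h)) - a i • C (f h)‖ ^ 2 ≤ ε ^ 2 * ‖C (f h)‖ ^ 2 := by
  obtain ⟨χ, hχ⟩ := hD.exists_character hh
  set a : ι → ℂ := fun i => χ ⟨A i, hA i⟩ with ha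
  set R : ι → B H := fun i => A i - a i • 1 with hR
  have hRD : ∀ i, R i ∈ D := fun i => sub_mem (hA i) (smul_one_mem D _)
  have hχR : ∀ i, χ ⟨R i, hRD i⟩ = 0 := fun i => by
    have : (⟨R i, hRD i⟩ : D) = ⟨A i, hA i⟩ - a i • 1 := Subtype.ext (by simp [hR])
    rw [this, map_sub, map_smul, map_one]
    simp [ha]
  set S : B H := ∑ i ∈ s, star (R i) * R i with hS
  have hSD : S ∈ D := sum_mem fun i _ => mul_mem (star_mem (hRD i)) (hRD i)
  have hχS : χ ⟨S, hSD⟩ = 0 := by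
    have : (⟨S, hSD⟩ : D) = ∑ i ∈ s, star ⟨R i, hRD i⟩ * ⟨R i, hRD i⟩ :=
      Subtype.ext (by simp [hS])
    rw [this, map_sum]
    exact Finset.sum_eq_zero fun i _ => by rw [map_mul, hχR, mul_zero]
  have hSs : IsSelfAdjoint S := by
    rw [isSelfAdjoint_iff, hS, star_sum]
    simp
  set G : B H := ((ε ^ 2 : ℝ) : ℂ) • (1 : B H) - S with hG
  have hGD : G ∈ D := sub_mem (smul_one_mem D _) hSD
  have hGs : IsSelfAdjoint G := (isSelfAdjoint_smul_one _).sub hSs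
  refine ⟨G⁺, hD.posPart_mem hGD, fun h0 => ?_, a, fun C hC => ?_⟩
  · have hu := isUnit_smul_one_add (CFC.negPart_nonneg G) (pow_pos hε 2)
    refine hD.apply_ne_zero_of_isUnit χ
      (f := ⟨_, add_mem (smul_one_mem D _) (hD.negPart_mem hGD)⟩) hu ?_
    have : (⟨_, add_mem (smul_one_mem D ((ε ^ 2 : ℝ) : ℂ)) (hD.negPart_mem hGD)⟩ : D) =
        ⟨G⁺, hD.posPart_mem hGD⟩ + ⟨S, hSD⟩ := Subtype.ext <| by
      have h1 := CFC.posPart_sub_negPart G hGs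
      change ((ε ^ 2 : ℝ) : ℂ) • (1 : B H) + G⁻ = G⁺ + S
      rw [sub_eq_iff_eq_add.1 h1, hG]
      abel
    rw [this, map_add, hχS, hχ _ h0, add_zero]
  · have h1 := hD.re_inner_posPart_nonneg hGD hGs hC h
    set v := C (G⁺ h)
    have h2 : (⟪S v, v⟫_ℂ).re = ∑ i ∈ s, ‖A i v - a i • v‖ ^ 2 := by
      rw [hS, _root_.sum_apply, sum_inner, Complex.re_sum]
      exact Finset.sum_congr rfl fun i _ => inner_star_mul_self_apply _ _
    have h3 := re_inner_smul_one_sub (ε ^ 2) S v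
    rw [← hG] at h3
    linarith

/-- The size of a module map at a vector controls its size on a localised submodule. -/
theorem IsMasa.exists_bound (hD : IsMasa D) {E : Type*} [NormedAddCommGroup E]
    [InnerProductSpace ℂ E] [CompleteSpace E] (ρ : B H → E →L[ℂ] E)
    (hρ : ∀ T, star (ρ T) = ρ (star T)) (V : H →L[ℂ] E)
    (hV : ∀ A ∈ D, ∀ u, V (A u) = ρ A (V u)) {h : H} {δ : ℝ} (hδ : 0 < δ)
    (hs : ‖V h‖ < δ * ‖h‖) :
    ∃ f ∈ D, f h ≠ 0 ∧ ∀ C ∈ D, ‖V (C (f h))‖ ≤ δ * ‖C (f h)‖ := by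
  set K : B H := ContinuousLinearMap.adjoint V ∘L V with hK
  have hKi : ∀ u w, ⟪K u, w⟫_ℂ = ⟪V u, V w⟫_ℂ := fun u w =>
    ContinuousLinearMap.adjoint_inner_left V w (V u)
  have hKD : K ∈ D := hD.mem_of_commute fun C hC => by
    refine ContinuousLinearMap.ext fun u => ext_inner_right ℂ fun w => ?_
    change ⟪C (K u), w⟫_ℂ = ⟪K (C u), w⟫_ℂ
    rw [← ContinuousLinearMap.adjoint_inner_right, hKi, hKi, hV C hC,
      ← ContinuousLinearMap.star_eq_adjoint, hV _ (star_mem hC), ← hρ,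
      ContinuousLinearMap.star_eq_adjoint, ContinuousLinearMap.adjoint_inner_right]
  have hKs : IsSelfAdjoint K := by
    rw [ContinuousLinearMap.isSelfAdjoint_iff_isSymmetric]
    intro u w
    change ⟪K u, w⟫_ℂ = ⟪u, K w⟫_ℂ
    rw [hKi, ← inner_conj_symm u, hKi, inner_conj_symm]
  set G : B H := ((δ ^ 2 : ℝ) : ℂ) • (1 : B H) - K with hG
  have hGi : ∀ v, (⟪G v, v⟫_ℂ).re = δ ^ 2 * ‖v‖ ^ 2 - ‖V v‖ ^ 2 := fun v => by
    rw [hG, re_inner_smul_one_sub, hKi, inner_self_eq_norm_sq_to_K]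
    norm_cast
  obtain ⟨f, hf, hfh, hfp⟩ := hD.exists_nonneg_on (G := G) (h := h)
    (sub_mem (smul_one_mem D _) hKD) ((isSelfAdjoint_smul_one _).sub hKs) (by
      rw [hGi, ← mul_pow, sub_pos]
      exact pow_lt_pow_left₀ hs (norm_nonneg _) two_ne_zero)
  refine ⟨f, hf, hfh, fun C hC => le_of_sq_le_sq ?_ (by positivity)⟩
  have := hfp C hC
  rw [hGi] at this
  rw [mul_pow]
  linarith

/-- Near a given vector, a module map into a Hilbert sum of copies of `H` is approximated by a
map commuting with all of `B H`. -/
theorem IsMasa.exists_approx (hD : IsMasa D) {ι : Type} (V : H →L[ℂ] HSum ι H)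
    (hV : ∀ A ∈ D, ∀ u, V (A u) = amp ι A (V u)) {h : H} (hh : h ≠ 0) {δ : ℝ} (hδ : 0 < δ) :
    ∃ f ∈ D, f h ≠ 0 ∧ ∃ J : H →L[ℂ] HSum ι H, (∀ T u, J (T u) = amp ι T (J u)) ∧
      ∀ C ∈ D, ‖V (C (f h)) - J (C (f h))‖ ≤ δ * ‖C (f h)‖ := by
  classical
  set A : ι → B H := fun i => lp.evalCLM ℂ (fun _ : ι => H) 2 i ∘L V with hA
  have hAa : ∀ i u, A i u = V u i := fun i u => rfl
  have hAD : ∀ i, A i ∈ D := fun i => hD.mem_of_commute fun C hC => by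
    ext u
    change C (V u i) = V (C u) i
    rw [hV C hC, amp_apply]
  set S : ι → H →L[ℂ] HSum ι H :=
    fun i => lp.singleContinuousLinearMap ℂ (fun _ : ι => H) 2 i with hS
  have hSa : ∀ i u, S i u = lp.single 2 i u := fun i u => rfl
  have hSD : ∀ i T u, S i (T u) = amp ι T (S i u) := fun i T u => by
    ext j
    rw [amp_apply, hSa, hSa, lp.single_apply, lp.single_apply]
    by_cases hj : j = i
    · subst hj; simp
    · simp [hj]
  have hnorm : ∀ (s : Finset ι) (g : ι → H), ‖∑ i ∈ s, S i (g i)‖ ^ 2 = ∑ i ∈ s, ‖g i‖ ^ 2 :=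
    fun s g => by
      have := lp.norm_sum_single (p := 2) (by norm_num) g s
      norm_num at this
      exact this
  obtain ⟨s, hs⟩ : ∃ s : Finset ι, ‖V h - ∑ i ∈ s, S i (A i h)‖ < δ / 2 * ‖h‖ := by
    have h1 : HasSum (fun i => S i (A i h)) (V h) := lp.hasSum_single (by norm_num) (V h)
    have h2 : 0 < δ / 2 * ‖h‖ := mul_pos (by linarith) (norm_pos_iff.2 hh)
    obtain ⟨s, hs⟩ := (h1.eventually (Metric.ball_mem_nhds _ h2)).exists
    exact ⟨s, by simpa [dist_eq_norm, norm_sub_rev] using hs⟩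
  set V' : H →L[ℂ] HSum ι H := V - ∑ i ∈ s, S i ∘L A i with hV'
  have hV'a : ∀ u, V' u = V u - ∑ i ∈ s, S i (A i u) := fun u => by
    simp [hV']
  have hV'D : ∀ C ∈ D, ∀ u, V' (C u) = amp ι C (V' u) := fun C hC u => by
    rw [hV'a, hV'a, map_sub, map_sum, hV C hC]
    congr 1
    refine Finset.sum_congr rfl fun i _ => ?_
    rw [← hSD]
    exact congrArg (fun T : B H => S i (T u)) (hD.1 _ (hAD i) _ hC)
  obtain ⟨f₁, hf₁, hf₁h, hf₁p⟩ := hD.exists_bound (amp ι) (fun _ => star_amp _) V' hV'D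
    (half_pos hδ) (by rw [hV'a]; exact hs)
  obtain ⟨f₂, hf₂, hf₂h, a, ha⟩ := hD.exists_scalars hf₁h s A hAD (half_pos hδ)
  have hcomm : f₂ (f₁ h) = (f₂ * f₁) h := rfl
  refine ⟨f₂ * f₁, mul_mem hf₂ hf₁, hf₂h, ∑ i ∈ s, a i • S i, fun T u => ?_, fun C hC => ?_⟩
  · simp only [_root_.sum_apply, _root_.smul_apply, map_sum, map_smul,
      hSD]
  · rw [← hcomm]
    have h1 := hf₁p (C * f₂) (mul_mem hC hf₂)
    have h2 := ha C hC
    change ‖V' (C (f₂ (f₁ h)))‖ ≤ δ / 2 * ‖C (f₂ (f₁ h))‖ at h1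
    set v := C (f₂ (f₁ h))
    have h3 : ‖∑ i ∈ s, S i (A i v - a i • v)‖ ≤ δ / 2 * ‖v‖ := by
      refine le_of_sq_le_sq ?_ (by positivity)
      rw [hnorm, mul_pow]
      exact h2
    have h4 : V v - (∑ i ∈ s, a i • S i) v = V' v + ∑ i ∈ s, S i (A i v - a i • v) := by
      rw [hV'a]
      simp [Finset.sum_sub_distrib]
    rw [h4]
    linarith [norm_add_le (V' v) (∑ i ∈ s, S i (A i v - a i • v))]

end SchurHyper

namespace SchurHyper

variable {H : Type*} [NormedAddCommGroup H] [InnerProductSpace ℂ H]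

/-- The map `Φ` annihilates the pair `(ξ, η)`. -/
def Null (Φ : B H →L[ℂ] B H) (ξ η : H) : Prop := ∀ T, ⟪η, Φ T ξ⟫_ℂ = 0

/-- The vectors `ξ` such that `Φ` annihilates `(ξ, η)`. -/
def nullL (Φ : B H →L[ℂ] B H) (η : H) : Submodule ℂ H where
  carrier := {ξ | Null Φ ξ η}
  add_mem' := fun {a b} (ha : Null Φ a η) (hb : Null Φ b η) T => by
    rw [map_add, inner_add_right, ha, hb, add_zero]
  zero_mem' := fun T => by simp
  smul_mem' := fun c a (ha : Null Φ a η) T => by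
    rw [map_smul, inner_smul_right, ha, mul_zero]

/-- The vectors `η` such that `Φ` annihilates `(ξ, η)`. -/
def nullR (Φ : B H →L[ℂ] B H) (ξ : H) : Submodule ℂ H where
  carrier := {η | Null Φ ξ η}
  add_mem' := fun {a b} (ha : Null Φ ξ a) (hb : Null Φ ξ b) T => by
    rw [inner_add_left, ha, hb, add_zero]
  zero_mem' := fun T => by simp
  smul_mem' := fun c a (ha : Null Φ ξ a) T => by
    rw [inner_smul_left, ha, mul_zero]

theorem mem_nullL {Φ : B H →L[ℂ] B H} {ξ η : H} : ξ ∈ nullL Φ η ↔ Null Φ ξ η := Iff.rfl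

theorem mem_nullR {Φ : B H →L[ℂ] B H} {ξ η : H} : η ∈ nullR Φ ξ ↔ Null Φ ξ η := Iff.rfl

theorem isClosed_nullL (Φ : B H →L[ℂ] B H) (η : H) : IsClosed (nullL Φ η : Set H) := by
  have : (nullL Φ η : Set H) = ⋂ T, {ξ | ⟪η, Φ T ξ⟫_ℂ = 0} := by
    ext ξ
    simp only [Set.mem_iInter]
    rfl
  rw [this]
  exact isClosed_iInter fun T => isClosed_eq (by fun_prop) continuous_const

theorem isClosed_nullR (Φ : B H →L[ℂ] B H) (ξ : H) : IsClosed (nullR Φ ξ : Set H) := by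
  have : (nullR Φ ξ : Set H) = ⋂ T, {η | ⟪η, Φ T ξ⟫_ℂ = 0} := by
    ext ξ
    simp only [Set.mem_iInter]
    rfl
  rw [this]
  exact isClosed_iInter fun T => isClosed_eq (by fun_prop) continuous_const

theorem Null.ne_zero_left {Φ : B H →L[ℂ] B H} {ξ η : H} (h : ¬ Null Φ ξ η) : ξ ≠ 0 :=
  fun h0 => h (h0 ▸ (nullL Φ η).zero_mem)

theorem Null.ne_zero_right {Φ : B H →L[ℂ] B H} {ξ η : H} (h : ¬ Null Φ ξ η) : η ≠ 0 :=
  fun h0 => h (h0 ▸ (nullR Φ ξ).zero_mem)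

variable [CompleteSpace H]

/-- A subspace invariant under the algebra `D`. -/
def Inv (D : StarSubalgebra ℂ (B H)) (P : Submodule ℂ H) : Prop := ∀ A ∈ D, ∀ v ∈ P, A v ∈ P

/-- The map `Φ` is a `D`-bimodule map. -/
def IsBimoduleMap (D : StarSubalgebra ℂ (B H)) (Φ : B H →L[ℂ] B H) : Prop :=
  ∀ A ∈ D, ∀ C ∈ D, ∀ T : B H, Φ (A * T * C) = A * Φ T * C

variable {D : StarSubalgebra ℂ (B H)} {Φ : B H →L[ℂ] B H}

theorem inner_star_apply {E : Type*} [NormedAddCommGroup E] [InnerProductSpace ℂ E]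
    [CompleteSpace E] (A : E →L[ℂ] E) (u v : E) : ⟪u, star A v⟫_ℂ = ⟪A u, v⟫_ℂ := by
  rw [ContinuousLinearMap.star_eq_adjoint, ContinuousLinearMap.adjoint_inner_right]

theorem star_apply_inner {E : Type*} [NormedAddCommGroup E] [InnerProductSpace ℂ E]
    [CompleteSpace E] (A : E →L[ℂ] E) (u v : E) : ⟪star A u, v⟫_ℂ = ⟪u, A v⟫_ℂ := by
  rw [ContinuousLinearMap.star_eq_adjoint, ContinuousLinearMap.adjoint_inner_left]

theorem IsBimoduleMap.inner_apply (hb : IsBimoduleMap D Φ) {A C : B H} (hA : A ∈ D) (hC : C ∈ D)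
    (T : B H) (ξ η : H) : ⟪A η, Φ T (C ξ)⟫_ℂ = ⟪η, Φ (star A * T * C) ξ⟫_ℂ := by
  rw [hb _ (star_mem hA) _ hC, ← inner_star_apply]
  rfl

theorem IsBimoduleMap.inv_nullL (hb : IsBimoduleMap D Φ) (η : H) : Inv D (nullL Φ η) :=
  fun A hA ξ hξ T => by
    have := hb.inner_apply (one_mem D) hA T ξ η
    exact this.trans (hξ _)

theorem IsBimoduleMap.inv_nullR (hb : IsBimoduleMap D Φ) (ξ : H) : Inv D (nullR Φ ξ) :=
  fun A hA η hη T => by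
    have := hb.inner_apply hA (one_mem D) T ξ η
    exact this.trans (hη _)

theorem Inv.orthogonal {P : Submodule ℂ H} (hP : Inv D P) : Inv D Pᗮ := fun A hA v hv => by
  rw [Submodule.mem_orthogonal] at hv ⊢
  intro u hu
  rw [← star_apply_inner]
  exact hv _ (hP _ (star_mem hA) u hu)

theorem Inv.inf {P Q : Submodule ℂ H} (hP : Inv D P) (hQ : Inv D Q) : Inv D (P ⊓ Q) :=
  fun A hA v hv => ⟨hP A hA v hv.1, hQ A hA v hv.2⟩

theorem Inv.starProjection_mem (hD : IsMasa D) {P : Submodule ℂ H} [P.HasOrthogonalProjection]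
    (hP : Inv D P) : P.starProjection ∈ D := hD.mem_of_commute fun A hA => by
  ext v
  change A (P.starProjection v) = P.starProjection (A v)
  refine (Submodule.eq_starProjection_of_mem_orthogonal
    (hP A hA _ (P.starProjection_apply_mem v)) ?_).symm
  rw [← map_sub]
  exact hP.orthogonal A hA _ (Submodule.sub_starProjection_mem_orthogonal v)

omit [CompleteSpace H] in
theorem eq_zero_of_mem_orthogonal {N : Submodule ℂ H} {v : H} (h : v ∈ N) (ho : v ∈ Nᗮ) :
    v = 0 := inner_self_eq_zero.1 (N.inner_right_of_mem_orthogonal h ho)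

/-- A masa can move a vector outside a closed invariant subspace into its complement. -/
theorem Inv.exists_mem_orthogonal (hD : IsMasa D) {N : Submodule ℂ H} (hN : IsClosed (N : Set H))
    (hND : Inv D N) {ξ : H} (hξ : ξ ∉ N) : ∃ g ∈ D, g ξ ≠ 0 ∧ g ξ ∈ Nᗮ := by
  have : CompleteSpace N := hN.completeSpace_coe
  refine ⟨1 - N.starProjection, sub_mem (one_mem D) (hND.starProjection_mem hD), fun h => ?_, ?_⟩
  · refine hξ ?_
    have h1 : ξ = N.starProjection ξ := sub_eq_zero.1 h
    rw [h1]
    exact N.starProjection_apply_mem ξ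
  · exact Submodule.sub_starProjection_mem_orthogonal ξ

omit [CompleteSpace H] in
theorem isClosed_inf_orthogonal {P : Submodule ℂ H} (hP : IsClosed (P : Set H))
    (N : Submodule ℂ H) : IsClosed ((P ⊓ Nᗮ : Submodule ℂ H) : Set H) :=
  hP.inter N.isClosed_orthogonal

/-- The first leg of a spatial representation of `Φ + id` can be made a module map. -/
theorem exists_left_leg (hD : IsMasa D) (hw : WStarContinuous H Φ) (hb : IsBimoduleMap D Φ)
    {P : Submodule ℂ H} (hP : IsClosed (P : Set H)) (hPD : Inv D P) {ξ η : H} (hξ : ξ ∈ P)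
    (hn : ¬ Null Φ ξ η) :
    ∃ (ι : Type) (i : ι) (y : HSum ι H) (V : H →L[ℂ] HSum ι H) (h : H),
      y i = η ∧ (∀ A ∈ D, ∀ u, V (A u) = amp ι A (V u)) ∧ h ∈ P ∧ ¬ Null Φ h η ∧
      ∀ T, ⟪η, Φ T h + T h⟫_ℂ = ⟪y, amp ι T (V h)⟫_ℂ := by
  obtain ⟨g, hg, hgξ, hgN⟩ :=
    (hb.inv_nullL η).exists_mem_orthogonal hD (isClosed_nullL Φ η) (ξ := ξ) hn
  obtain ⟨ι, i, x, y, hx, hy, hxy⟩ := exists_spatial_add Φ hw (g ξ) η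
  set P₁ := P ⊓ (nullL Φ η)ᗮ with hP₁
  have hP₁D : Inv D P₁ := hPD.inf (hb.inv_nullL η).orthogonal
  have hP₁c : IsClosed (P₁ : Set H) := isClosed_inf_orthogonal hP _
  let ev : HSum ι H →L[ℂ] H := lp.evalCLM ℂ (fun _ : ι => H) 2 i
  have hev : ∀ v, ev v = v i := fun _ => rfl
  let L : Submodule ℂ (HSum ι H) :=
    { carrier := {v | ev v ∈ P₁ ∧ ∀ T, ⟪η, Φ T (ev v) + T (ev v)⟫_ℂ = ⟪y, amp ι T v⟫_ℂ}
      add_mem' := fun {a b} ha hb => ⟨by rw [map_add]; exact P₁.add_mem ha.1 hb.1, fun T => by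
        have h1 := ha.2 T
        have h2 := hb.2 T
        simp only [map_add, inner_add_right] at h1 h2 ⊢
        linear_combination h1 + h2⟩
      zero_mem' := ⟨by simp, fun T => by simp⟩
      smul_mem' := fun c a ha => ⟨by rw [map_smul]; exact P₁.smul_mem _ ha.1, fun T => by
        have h1 := ha.2 T
        simp only [map_smul, inner_add_right, inner_smul_right] at h1 ⊢
        linear_combination c * h1⟩ }
  have hLmem : ∀ v, v ∈ L ↔
      ev v ∈ P₁ ∧ ∀ T, ⟪η, Φ T (ev v) + T (ev v)⟫_ℂ = ⟪y, amp ι T v⟫_ℂ := fun v => Iff.rfl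
  have hLc : IsClosed (L : Set (HSum ι H)) := by
    have : (L : Set (HSum ι H)) = ev ⁻¹' (P₁ : Set H) ∩
        ⋂ T, {v | ⟪η, Φ T (ev v) + T (ev v)⟫_ℂ = ⟪y, amp ι T v⟫_ℂ} := by
      ext v
      simp only [Set.mem_inter_iff, Set.mem_iInter]
      rfl
    rw [this]
    exact (hP₁c.preimage ev.continuous).inter
      (isClosed_iInter fun T => isClosed_eq (by fun_prop) (by fun_prop))
  have hLD : ∀ A ∈ D, ∀ v ∈ L, amp ι A v ∈ L := fun A hA v hv => by
    refine ⟨hP₁D A hA _ hv.1, fun T => ?_⟩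
    have h1 := hv.2 (T * A)
    have h2 := hb 1 (one_mem D) A hA T
    rw [one_mul, one_mul] at h2
    rw [h2, amp_mul] at h1
    exact h1
  obtain ⟨V, hVL, hVD, h, hh, hVh⟩ := hD.exists_intertwiner (amp ι) (fun _ => star_amp _) L hLc hLD
    ev (fun A _ v => rfl) (m := x) ⟨by
      rw [hev, hx]; exact ⟨hPD _ hg _ hξ, hgN⟩, fun T => by rw [hev, hx]; exact hxy T⟩
    (by rw [hev, hx]; exact hgξ)
  have h3 := hVL h
  rw [hLmem, hVh] at h3
  exact ⟨ι, i, y, V, h, hy, hVD, h3.1.1,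
    fun h0 => hh (eq_zero_of_mem_orthogonal (mem_nullL.2 h0) h3.1.2), h3.2⟩

/-- The second leg of a spatial representation of `Φ + id` can be made a module map. -/
theorem exists_right_leg (hD : IsMasa D) (hb : IsBimoduleMap D Φ)
    {Q : Submodule ℂ H} (hQ : IsClosed (Q : Set H)) (hQD : Inv D Q) {h η : H} (hη : η ∈ Q)
    (hn : ¬ Null Φ h η) {ι : Type} {i : ι} {x y : HSum ι H} (hy : y i = η)
    (hxy : ∀ T, ⟪η, Φ T h + T h⟫_ℂ = ⟪y, amp ι T x⟫_ℂ) :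
    ∃ (W : H →L[ℂ] HSum ι H) (k : H),
      (∀ A ∈ D, ∀ u, W (A u) = amp ι A (W u)) ∧ k ∈ Q ∧ ¬ Null Φ h k ∧
      ∀ T, ⟪k, Φ T h + T h⟫_ℂ = ⟪W k, amp ι T x⟫_ℂ := by
  obtain ⟨g, hg, hgη, hgN⟩ :=
    (hb.inv_nullR h).exists_mem_orthogonal hD (isClosed_nullR Φ h) (ξ := η) hn
  set Q₁ := Q ⊓ (nullR Φ h)ᗮ with hQ₁
  have hQ₁D : Inv D Q₁ := hQD.inf (hb.inv_nullR h).orthogonal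
  have hQ₁c : IsClosed (Q₁ : Set H) := isClosed_inf_orthogonal hQ _
  let ev : HSum ι H →L[ℂ] H := lp.evalCLM ℂ (fun _ : ι => H) 2 i
  have hev : ∀ v, ev v = v i := fun _ => rfl
  let L : Submodule ℂ (HSum ι H) :=
    { carrier := {v | ev v ∈ Q₁ ∧ ∀ T, ⟪ev v, Φ T h + T h⟫_ℂ = ⟪v, amp ι T x⟫_ℂ}
      add_mem' := fun {a b} ha hb => ⟨by rw [map_add]; exact Q₁.add_mem ha.1 hb.1, fun T => by
        rw [map_add, inner_add_left, inner_add_left, ha.2, hb.2]⟩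
      zero_mem' := ⟨by simp, fun T => by simp⟩
      smul_mem' := fun c a ha => ⟨by rw [map_smul]; exact Q₁.smul_mem _ ha.1, fun T => by
        rw [map_smul, inner_smul_left, inner_smul_left, ha.2]⟩ }
  have hLmem : ∀ v, v ∈ L ↔
      ev v ∈ Q₁ ∧ ∀ T, ⟪ev v, Φ T h + T h⟫_ℂ = ⟪v, amp ι T x⟫_ℂ := fun v => Iff.rfl
  have hLc : IsClosed (L : Set (HSum ι H)) := by
    have : (L : Set (HSum ι H)) = ev ⁻¹' (Q₁ : Set H) ∩
        ⋂ T, {v | ⟪ev v, Φ T h + T h⟫_ℂ = ⟪v, amp ι T x⟫_ℂ} := by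
      ext v
      simp only [Set.mem_inter_iff, Set.mem_iInter]
      rfl
    rw [this]
    exact (hQ₁c.preimage ev.continuous).inter
      (isClosed_iInter fun T => isClosed_eq (by fun_prop) (by fun_prop))
  have key : ∀ A ∈ D, ∀ v : HSum ι H,
      (∀ T, ⟪ev v, Φ T h + T h⟫_ℂ = ⟪v, amp ι T x⟫_ℂ) →
      ∀ T, ⟪A (ev v), Φ T h + T h⟫_ℂ = ⟪amp ι A v, amp ι T x⟫_ℂ := fun A hA v hv T => by
    have h1 := hv (star A * T)
    have h2 := hb _ (star_mem hA) 1 (one_mem D) T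
    rw [mul_one, mul_one] at h2
    rw [h2, amp_mul, ← star_amp] at h1
    rw [← inner_star_apply, map_add]
    refine h1.trans ?_
    change ⟪v, star (amp ι A) (amp ι T x)⟫_ℂ = _
    rw [ContinuousLinearMap.star_eq_adjoint, ContinuousLinearMap.adjoint_inner_right]
  have hLD : ∀ A ∈ D, ∀ v ∈ L, amp ι A v ∈ L := fun A hA v hv =>
    ⟨hQ₁D A hA _ hv.1, key A hA v hv.2⟩
  obtain ⟨W, hWL, hWD, k, hk, hWk⟩ := hD.exists_intertwiner (amp ι) (fun _ => star_amp _) L hLc hLD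
    ev (fun A _ v => rfl) (m := amp ι g y) ⟨by
      rw [hev, amp_apply, hy]; exact ⟨hQD _ hg _ hη, hgN⟩, fun T => by
        exact key g hg y (fun T => by rw [hev, hy]; exact hxy T) T⟩
    (by rw [hev, amp_apply, hy]; exact hgη)
  have h3 := hWL k
  rw [hLmem, hWk] at h3
  exact ⟨W, k, hWD, h3.1.1,
    fun h0 => hk (eq_zero_of_mem_orthogonal (mem_nullR.2 h0) h3.1.2), h3.2⟩

end SchurHyper

namespace SchurHyper

variable {H : Type*} [NormedAddCommGroup H] [InnerProductSpace ℂ H] [CompleteSpace H]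
variable {D : StarSubalgebra ℂ (B H)} {Φ : B H →L[ℂ] B H}

/-- Two maps commuting with the action of `B H` compose to a scalar. -/
theorem exists_scalar_of_intertwine {ι : Type} (J J' : H →L[ℂ] HSum ι H)
    (hJ : ∀ T u, J (T u) = amp ι T (J u)) (hJ' : ∀ T u, J' (T u) = amp ι T (J' u)) :
    ∃ c : ℂ, ∀ (T : B H) u w, ⟪J' w, amp ι T (J u)⟫_ℂ = c * ⟪w, T u⟫_ℂ := by
  set R : B H := ContinuousLinearMap.adjoint J' ∘L J with hR
  have hRi : ∀ u w, ⟪w, R u⟫_ℂ = ⟪J' w, J u⟫_ℂ := fun u w =>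
    ContinuousLinearMap.adjoint_inner_right J' w (J u)
  have hcomm : ∀ T : B H, Commute R T := fun T => by
    refine ContinuousLinearMap.ext fun u => ext_inner_left ℂ fun w => ?_
    change ⟪w, R (T u)⟫_ℂ = ⟪w, T (R u)⟫_ℂ
    rw [hRi, ← star_apply_inner, hRi, hJ, hJ', ← star_amp, star_apply_inner]
  obtain ⟨c, hc⟩ : ∃ c : ℂ, R = c • 1 := by
    have := Algebra.IsCentral.out (K := ℂ) (D := B H) (show R ∈ Subalgebra.center ℂ (B H) from
      Subalgebra.mem_center_iff.2 fun T => (hcomm T).eq.symm)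
    obtain ⟨c, hc⟩ := Algebra.mem_bot.1 this
    exact ⟨c, by rw [← hc, Algebra.algebraMap_eq_smul_one]⟩
  refine ⟨c, fun T u w => ?_⟩
  rw [← hJ, ← hRi, hc]
  simp

omit [CompleteSpace H] in
theorem norm_inner_amp_sub_le {ι : Type} (a a' b b' : HSum ι H) (T : B H) {α β γ κ : ℝ}
    (h1 : ‖a‖ ≤ α) (h2 : ‖b - b'‖ ≤ β) (h3 : ‖a - a'‖ ≤ γ) (h4 : ‖b'‖ ≤ κ) :
    ‖⟪a, amp ι T b⟫_ℂ - ⟪a', amp ι T b'⟫_ℂ‖ ≤ ‖T‖ * (α * β + γ * κ) := by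
  have e : ⟪a, amp ι T b⟫_ℂ - ⟪a', amp ι T b'⟫_ℂ =
      ⟪a, amp ι T (b - b')⟫_ℂ + ⟪a - a', amp ι T b'⟫_ℂ := by
    rw [map_sub, inner_sub_right, inner_sub_left]
    ring
  have hα : 0 ≤ α := (norm_nonneg _).trans h1
  have hγ : 0 ≤ γ := (norm_nonneg _).trans h3
  have hT : ∀ v, ‖amp ι T v‖ ≤ ‖T‖ * ‖v‖ := fun v => (amp ι T).le_of_opNorm_le (norm_amp_le _ _) v
  have h5 : ‖⟪a, amp ι T (b - b')⟫_ℂ‖ ≤ α * (‖T‖ * β) :=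
    (norm_inner_le_norm _ _).trans (by gcongr; exact (hT _).trans (by gcongr))
  have h6 : ‖⟪a - a', amp ι T b'⟫_ℂ‖ ≤ γ * (‖T‖ * κ) :=
    (norm_inner_le_norm _ _).trans (by gcongr; exact (hT _).trans (by gcongr))
  rw [e]
  refine (norm_add_le _ _).trans ?_
  linarith

/-- A non-annihilated pair can be localised so that `Φ` is almost a multiple of the identity. -/
theorem exists_almost_scalar (hD : IsMasa D) (hw : WStarContinuous H Φ) (hb : IsBimoduleMap D Φ)
    {P Q : Submodule ℂ H} (hP : IsClosed (P : Set H)) (hPD : Inv D P)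
    (hQ : IsClosed (Q : Set H)) (hQD : Inv D Q) {ξ η : H} (hξ : ξ ∈ P) (hη : η ∈ Q)
    (hn : ¬ Null Φ ξ η) :
    ∃ h ∈ P, ∃ k ∈ Q, ¬ Null Φ h k ∧ ∃ c : ℂ, ∀ (T : B H), ∀ C ∈ D, ∀ A ∈ D,
      ‖⟪A k, Φ T (C h)⟫_ℂ - c * ⟪A k, T (C h)⟫_ℂ‖ ≤ 1 / 4 * ‖T‖ * ‖C h‖ * ‖A k‖ := by
  obtain ⟨ι, i, y, V, h, hy, hV, hhP, hhn, hxy⟩ := exists_left_leg hD hw hb hP hPD hξ hn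
  obtain ⟨W, k, hW, hkQ, hkn, hxy'⟩ := exists_right_leg hD hb hQ hQD hη hhn hy hxy
  have hrep : ∀ (T : B H), ∀ C ∈ D, ∀ A ∈ D,
      ⟪A k, Φ T (C h)⟫_ℂ + ⟪A k, T (C h)⟫_ℂ = ⟪W (A k), amp ι T (V (C h))⟫_ℂ :=
    fun T C hC A hA => by
      have h1 := hxy' (star A * T * C)
      rw [hb _ (star_mem hA) _ hC, amp_mul, amp_mul, ← star_amp, inner_add_right] at h1
      have e1 : ⟪k, (star A * Φ T * C) h⟫_ℂ = ⟪A k, Φ T (C h)⟫_ℂ := inner_star_apply A k _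
      have e2 : ⟪k, (star A * T * C) h⟫_ℂ = ⟪A k, T (C h)⟫_ℂ := inner_star_apply A k _
      rw [e1, e2] at h1
      rw [h1, hV C hC, hW A hA]
      exact inner_star_apply (amp ι A) (W k) (amp ι T (amp ι C (V h)))
  obtain ⟨g, hg, hgh, hgN⟩ :=
    (hb.inv_nullL k).exists_mem_orthogonal hD (isClosed_nullL Φ k) (ξ := h) hkn
  have hWp : 0 < 8 * (‖W‖ + 1) := by positivity
  obtain ⟨f, hf, hfh, J, hJ, hJV⟩ := hD.exists_approx V hV hgh (inv_pos.2 hWp)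
  have hfN : f (g h) ∈ (nullL Φ k)ᗮ := (hb.inv_nullL k).orthogonal f hf _ hgN
  have hn' : ¬ Null Φ (f (g h)) k :=
    fun h0 => hfh (eq_zero_of_mem_orthogonal (mem_nullL.2 h0) hfN)
  obtain ⟨g', hg', hgk, hgN'⟩ :=
    (hb.inv_nullR (f (g h))).exists_mem_orthogonal hD (isClosed_nullR Φ _) (ξ := k) hn'
  have hJp : 0 < 8 * (‖J‖ + 1) := by positivity
  obtain ⟨f', hf', hfk, J', hJ', hJW⟩ := hD.exists_approx W hW hgk (inv_pos.2 hJp)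
  have hfN' : f' (g' k) ∈ (nullR Φ (f (g h)))ᗮ := (hb.inv_nullR _).orthogonal f' hf' _ hgN'
  have hn'' : ¬ Null Φ (f (g h)) (f' (g' k)) :=
    fun h0 => hfk (eq_zero_of_mem_orthogonal (mem_nullR.2 h0) hfN')
  obtain ⟨c, hc⟩ := exists_scalar_of_intertwine J J' hJ hJ'
  refine ⟨_, hPD f hf _ (hPD g hg _ hhP), _, hQD f' hf' _ (hQD g' hg' _ hkQ), hn'', c - 1,
    fun T C hC A hA => ?_⟩
  have h1 := hrep T (C * (f * g)) (mul_mem hC (mul_mem hf hg)) (A * (f' * g'))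
    (mul_mem hA (mul_mem hf' hg'))
  change ⟪A (f' (g' k)), Φ T (C (f (g h)))⟫_ℂ + ⟪A (f' (g' k)), T (C (f (g h)))⟫_ℂ =
    ⟪W (A (f' (g' k))), amp ι T (V (C (f (g h))))⟫_ℂ at h1
  have h2 := hJV C hC
  have h3 := hJW A hA
  set u := C (f (g h))
  set w := A (f' (g' k))
  have h4 := norm_inner_amp_sub_le (W w) (J' w) (V u) (J u) T (W.le_opNorm w) h2 h3
    (J.le_opNorm u)
  have e : ⟪w, Φ T u⟫_ℂ - (c - 1) * ⟪w, T u⟫_ℂ =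
      ⟪W w, amp ι T (V u)⟫_ℂ - ⟪J' w, amp ι T (J u)⟫_ℂ := by
    rw [hc]
    linear_combination h1
  rw [e]
  refine h4.trans ?_
  have h5 : ‖W‖ * (8 * (‖W‖ + 1))⁻¹ ≤ 1 / 8 := by
    rw [← div_eq_mul_inv, div_le_iff₀ hWp]; linarith
  have h6 : (8 * (‖J‖ + 1))⁻¹ * ‖J‖ ≤ 1 / 8 := by
    rw [mul_comm, ← div_eq_mul_inv, div_le_iff₀ hJp]; linarith
  have h7 : 0 ≤ ‖T‖ * ‖u‖ * ‖w‖ := by positivity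
  nlinarith

/-- The closed cyclic subspace generated by a vector. -/
def cyc (D : StarSubalgebra ℂ (B H)) (h : H) : Submodule ℂ H :=
  (D.toSubalgebra.toSubmodule.map (ContinuousLinearMap.apply ℂ H h).toLinearMap).topologicalClosure

theorem isClosed_cyc (D : StarSubalgebra ℂ (B H)) (h : H) : IsClosed (cyc D h : Set H) :=
  Submodule.isClosed_topologicalClosure _

theorem mem_cyc (D : StarSubalgebra ℂ (B H)) (h : H) : h ∈ cyc D h :=
  Submodule.le_topologicalClosure _ ⟨1, one_mem D, rfl⟩

theorem cyc_induction {h : H} {p : H → Prop} (hp : IsClosed {u | p u}) (hD : ∀ C ∈ D, p (C h)) :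
    ∀ u ∈ cyc D h, p u := fun u hu => by
  refine closure_minimal (t := {u | p u}) ?_ hp hu
  rintro _ ⟨C, hC, rfl⟩
  exact hD C hC

theorem inv_cyc (D : StarSubalgebra ℂ (B H)) (h : H) : Inv D (cyc D h) := fun A hA u hu => by
  refine cyc_induction (p := fun u => A u ∈ cyc D h) ((isClosed_cyc D h).preimage A.continuous)
    (fun C hC => ?_) u hu
  exact Submodule.le_topologicalClosure _ ⟨A * C, show A * C ∈ D from mul_mem hA hC, rfl⟩

theorem norm_le_of_inner_le {S : B H} {a b : ℝ} (hb : 0 ≤ b) (ha : 0 ≤ a)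
    (h : ∀ u w, a * ‖⟪w, S u⟫_ℂ‖ ≤ b * ‖u‖ * ‖w‖) : a * ‖S‖ ≤ b := by
  have h1 : ‖(a : ℂ) • S‖ ≤ b := by
    refine ContinuousLinearMap.opNorm_le_bound _ hb fun u => ?_
    rw [_root_.smul_apply, norm_smul, Complex.norm_real, Real.norm_eq_abs, abs_of_nonneg ha]
    rcases (norm_nonneg (S u)).eq_or_lt with h0 | h0
    · rw [← h0, mul_zero]; positivity
    · have := h u (S u)
      rw [inner_self_eq_norm_sq_to_K] at this
      simp only [norm_pow, RCLike.norm_ofReal, abs_norm] at this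
      have h2 : (a * ‖S u‖) * ‖S u‖ ≤ (b * ‖u‖) * ‖S u‖ := by nlinarith
      exact le_of_mul_le_mul_right h2 h0
  rwa [norm_smul, Complex.norm_real, Real.norm_eq_abs, abs_of_nonneg ha] at h1

/-- Every non-annihilated pair of a Schur idempotent can be localised to a pair on which the
idempotent acts as the identity. -/
theorem exists_good (hD : IsMasa D) (hw : WStarContinuous H Φ) (hb : IsBimoduleMap D Φ)
    (hid : ∀ T, Φ (Φ T) = Φ T)
    {P Q : Submodule ℂ H} (hP : IsClosed (P : Set H)) (hPD : Inv D P)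
    (hQ : IsClosed (Q : Set H)) (hQD : Inv D Q) {ξ η : H} (hξ : ξ ∈ P) (hη : η ∈ Q)
    (hn : ¬ Null Φ ξ η) :
    ∃ h ∈ P, ∃ k ∈ Q, h ≠ 0 ∧ k ≠ 0 ∧ ∀ T, ⟪k, Φ T h⟫_ℂ = ⟪k, T h⟫_ℂ := by
  obtain ⟨h, hhP, k, hkQ, hhk, c, hc⟩ := exists_almost_scalar hD hw hb hP hPD hQ hQD hξ hη hn
  refine ⟨h, hhP, k, hkQ, Null.ne_zero_left hhk, Null.ne_zero_right hhk, ?_⟩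
  have hc' : ∀ (T : B H), ∀ u ∈ cyc D h, ∀ w ∈ cyc D k,
      ‖⟪w, Φ T u⟫_ℂ - c * ⟪w, T u⟫_ℂ‖ ≤ 1 / 4 * ‖T‖ * ‖u‖ * ‖w‖ := fun T u hu w hw => by
    refine cyc_induction (p := fun w => ‖⟪w, Φ T u⟫_ℂ - c * ⟪w, T u⟫_ℂ‖ ≤ 1 / 4 * ‖T‖ * ‖u‖ * ‖w‖)
      (isClosed_le (by fun_prop) (by fun_prop)) (fun A hA => ?_) w hw
    exact cyc_induction
      (p := fun u => ‖⟪A k, Φ T u⟫_ℂ - c * ⟪A k, T u⟫_ℂ‖ ≤ 1 / 4 * ‖T‖ * ‖u‖ * ‖A k‖)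
      (isClosed_le (by fun_prop) (by fun_prop)) (fun C hC => hc T C hC A hA) u hu
  have : CompleteSpace (cyc D h) := (isClosed_cyc D h).completeSpace_coe
  have : CompleteSpace (cyc D k) := (isClosed_cyc D k).completeSpace_coe
  set p : B H := (cyc D h).starProjection with hp
  set q : B H := (cyc D k).starProjection with hq
  have hpD : p ∈ D := (inv_cyc D h).starProjection_mem hD
  have hqD : q ∈ D := (inv_cyc D k).starProjection_mem hD
  have hpp : p * p = p := Submodule.isIdempotentElem_starProjection _
  have hqq : q * q = q := Submodule.isIdempotentElem_starProjection _
  have hph : p h = h := Submodule.starProjection_eq_self_iff.2 (mem_cyc D h)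
  have hqk : q k = k := Submodule.starProjection_eq_self_iff.2 (mem_cyc D k)
  have hqs : ∀ w v, ⟪w, q v⟫_ℂ = ⟪q w, v⟫_ℂ := fun w v =>
    ((cyc D k).inner_starProjection_left_eq_right w v).symm
  have bound : ∀ (l : ℂ) (S : B H), q * S * p = S → Φ S = l • S → S ≠ 0 → ‖l - c‖ ≤ 1 / 4 :=
    fun l S hS hl hS0 => by
      have hnS : 0 < ‖S‖ := norm_pos_iff.2 hS0
      refine le_of_mul_le_mul_right ?_ hnS
      refine norm_le_of_inner_le (by positivity) (norm_nonneg _) fun u w => ?_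
      have h1 := hc' S (p u) (Submodule.starProjection_apply_mem _ _) (q w)
        (Submodule.starProjection_apply_mem _ _)
      have e : ⟪w, S u⟫_ℂ = ⟪q w, S (p u)⟫_ℂ := by
        conv_lhs => rw [← hS]
        exact hqs w _
      rw [hl, _root_.smul_apply, inner_smul_right, ← sub_mul, norm_mul, ← e] at h1
      refine h1.trans ?_
      have h2 : ‖p u‖ ≤ ‖u‖ := Submodule.norm_starProjection_apply_le _ _
      have h3 : ‖q w‖ ≤ ‖w‖ := Submodule.norm_starProjection_apply_le _ _
      gcongr
  have hqTp : ∀ T, q * (q * T * p) * p = q * T * p := fun T => by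
    have : q * (q * T * p) * p = q * q * T * (p * p) := by simp only [mul_assoc]
    rw [this, hqq, hpp]
  have hval : ∀ T : B H, ⟪k, (q * T * p) h⟫_ℂ = ⟪k, T h⟫_ℂ := fun T => by
    change ⟪k, q (T (p h))⟫_ℂ = _
    rw [hqs, hqk, hph]
  by_contra! hbad
  obtain ⟨T, hT⟩ := hbad
  have b0 : ‖(0 : ℂ) - c‖ ≤ 1 / 4 := by
    refine bound 0 (q * (T - Φ T) * p) (hqTp _) ?_ fun h0 => hT ?_
    · rw [hb q hqD p hpD, map_sub, hid]
      simp
    · have := hval (T - Φ T)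
      rw [h0, _root_.sub_apply, inner_sub_right] at this
      simp only [_root_.zero_apply, inner_zero_right] at this
      exact (sub_eq_zero.1 this.symm).symm
  have b1 : ‖(1 : ℂ) - c‖ ≤ 1 / 4 := by
    obtain ⟨T', hT'⟩ : ∃ T', ⟪k, Φ T' h⟫_ℂ ≠ 0 := by
      by_contra! h0
      exact hhk h0
    refine bound 1 (q * Φ T' * p) (hqTp _) ?_ fun h0 => hT' ?_
    · rw [hb q hqD p hpD, hid, one_smul]
    · rw [← hval, h0]
      simp
  have h1 : ‖(1 : ℂ)‖ ≤ ‖(1 : ℂ) - c‖ + ‖(0 : ℂ) - c‖ := by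
    have := norm_sub_le ((1 : ℂ) - c) (0 - c)
    simpa using this
  rw [norm_one] at h1
  linarith

end SchurHyper

namespace SchurHyper

variable {H : Type*} [NormedAddCommGroup H] [InnerProductSpace ℂ H]

theorem WStarContinuous.compl {Φ : B H →L[ℂ] B H} (h : WStarContinuous H Φ) :
    WStarContinuous H (ContinuousLinearMap.id ℂ (B H) - Φ) := by
  refine (@continuous_induced_rng _ _ _ _ _ _ (weakStarTopology H)).2
    (@continuous_pi _ _ _ (weakStarTopology H) _ _ fun ω => ?_)
  have h0 : @Continuous _ _ (weakStarTopology H) _ fun T : B H => ω.1 T :=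
    @Continuous.comp _ _ _ (weakStarTopology H) _ _
      (fun T (ω : {ω : B H →ₗ[ℂ] ℂ // IsNormalFunctional H ω}) => ω.1 T) (fun p => p ω)
      (continuous_apply ω) continuous_induced_dom
  have h1 : @Continuous _ _ (weakStarTopology H) _ fun T : B H => ω.1 (Φ T) :=
    @Continuous.comp _ _ _ (weakStarTopology H) (weakStarTopology H) _ _ _ h0 h
  have h2 := @Continuous.sub _ _ (weakStarTopology H) _ _ _ _ _ h0 h1
  convert h2 using 2 with T
  exact map_sub ω.1 T (Φ T)

theorem compl_compl (Φ : B H →L[ℂ] B H) :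
    ContinuousLinearMap.id ℂ (B H) - (ContinuousLinearMap.id ℂ (B H) - Φ) = Φ :=
  sub_sub_cancel _ _

theorem null_compl_iff {Φ : B H →L[ℂ] B H} {ξ η : H} :
    Null (ContinuousLinearMap.id ℂ (B H) - Φ) ξ η ↔ ∀ T, ⟪η, Φ T ξ⟫_ℂ = ⟪η, T ξ⟫_ℂ := by
  refine forall_congr' fun T => ?_
  change ⟪η, T ξ - Φ T ξ⟫_ℂ = 0 ↔ _
  rw [inner_sub_right, sub_eq_zero, eq_comm]

/-- Only degenerate pairs are annihilated by both `Φ` and its complement. -/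
theorem eq_zero_or_eq_zero_of_null {Φ : B H →L[ℂ] B H} {ξ η : H} (h : Null Φ ξ η)
    (h' : Null (ContinuousLinearMap.id ℂ (B H) - Φ) ξ η) : ξ = 0 ∨ η = 0 := by
  have := null_compl_iff.1 h' (InnerProductSpace.rankOne ℂ η ξ)
  rw [h, InnerProductSpace.rankOne_apply, inner_smul_right, eq_comm, mul_eq_zero] at this
  exact this.imp inner_self_eq_zero.1 inner_self_eq_zero.1

variable [CompleteSpace H] {D : StarSubalgebra ℂ (B H)} {Φ : B H →L[ℂ] B H}

theorem IsSchurIdempotent.isBimoduleMap (h : IsSchurIdempotent D Φ) : IsBimoduleMap D Φ := h.1.2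

theorem IsSchurIdempotent.compl (h : IsSchurIdempotent D Φ) :
    IsSchurIdempotent D (ContinuousLinearMap.id ℂ (B H) - Φ) := by
  refine ⟨⟨h.1.1.compl, fun A hA C hC T => ?_⟩, ?_⟩
  · change A * T * C - Φ (A * T * C) = A * (T - Φ T) * C
    rw [h.1.2 A hA C hC, mul_sub, sub_mul]
  · refine ContinuousLinearMap.ext fun T => ?_
    have : Φ (Φ T) = Φ T := congrArg (fun F : B H →L[ℂ] B H => F T) h.2
    change T - Φ T - Φ (T - Φ T) = T - Φ T
    rw [map_sub, this, sub_self, sub_zero]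

theorem IsSchurIdempotent.exists_good (hD : IsMasa D) (h : IsSchurIdempotent D Φ)
    {P Q : Submodule ℂ H} (hP : IsClosed (P : Set H)) (hPD : Inv D P)
    (hQ : IsClosed (Q : Set H)) (hQD : Inv D Q) {ξ η : H} (hξ : ξ ∈ P) (hη : η ∈ Q)
    (hn : ¬ Null Φ ξ η) :
    ∃ h ∈ P, ∃ k ∈ Q, h ≠ 0 ∧ k ≠ 0 ∧ Null (ContinuousLinearMap.id ℂ (B H) - Φ) h k := by
  obtain ⟨x, hx, k, hk, hx0, hk0, hxk⟩ := SchurHyper.exists_good hD h.1.1 h.1.2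
    (fun T => congrArg (fun F : B H →L[ℂ] B H => F T) h.2) hP hPD hQ hQD hξ hη hn
  exact ⟨x, hx, k, hk, hx0, hk0, null_compl_iff.2 hxk⟩

theorem IsSchurIdempotent.exists_null (hD : IsMasa D) (h : IsSchurIdempotent D Φ)
    {P Q : Submodule ℂ H} (hP : IsClosed (P : Set H)) (hPD : Inv D P)
    (hQ : IsClosed (Q : Set H)) (hQD : Inv D Q) {ξ η : H} (hξ : ξ ∈ P) (hη : η ∈ Q)
    (hn : ¬ Null (ContinuousLinearMap.id ℂ (B H) - Φ) ξ η) :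
    ∃ h ∈ P, ∃ k ∈ Q, h ≠ 0 ∧ k ≠ 0 ∧ Null Φ h k := by
  have := h.compl.exists_good hD hP hPD hQ hQD hξ hη hn
  rwa [compl_compl] at this

/-- Disjoint closed invariant subspaces of a masa are orthogonal. -/
theorem Inv.le_orthogonal_of_disjoint (hD : IsMasa D) {P Q : Submodule ℂ H}
    (hP : IsClosed (P : Set H)) (hPD : Inv D P) (hQ : IsClosed (Q : Set H)) (hQD : Inv D Q)
    (h : ∀ v ∈ P, v ∈ Q → v = 0) : P ≤ Qᗮ := fun u hu => by
  have : CompleteSpace P := hP.completeSpace_coe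
  have : CompleteSpace Q := hQ.completeSpace_coe
  have h1 : Q.starProjection u ∈ P := hPD _ (hQD.starProjection_mem hD) u hu
  exact (Submodule.starProjection_apply_eq_zero_iff Q).1 (h _ h1 (Q.starProjection_apply_mem u))

theorem no_three_of_four_of_unit (hc : ‖Φ‖ ≤ 1) {ξ₁ ξ₂ η₁ η₂ : H} (hξ₁ : ‖ξ₁‖ = 1) (hξ₂ : ‖ξ₂‖ = 1)
    (hη₁ : ‖η₁‖ = 1) (hη₂ : ‖η₂‖ = 1) (hξ : ⟪ξ₁, ξ₂⟫_ℂ = 0) (hη : ⟪η₁, η₂⟫_ℂ = 0)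
    (h₁₁ : ∀ T, ⟪η₁, Φ T ξ₁⟫_ℂ = ⟪η₁, T ξ₁⟫_ℂ) (h₁₂ : ∀ T, ⟪η₂, Φ T ξ₁⟫_ℂ = ⟪η₂, T ξ₁⟫_ℂ)
    (h₂₁ : ∀ T, ⟪η₁, Φ T ξ₂⟫_ℂ = ⟪η₁, T ξ₂⟫_ℂ) (h₂₂ : Null Φ ξ₂ η₂) : False := by
  have hη' : ⟪η₂, η₁⟫_ℂ = 0 := inner_eq_zero_symm.1 hη
  have hξ' : ⟪ξ₂, ξ₁⟫_ℂ = 0 := inner_eq_zero_symm.1 hξ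
  have unit : ∀ v : H, ‖v‖ = 1 → ⟪v, v⟫_ℂ = 1 := fun v hv => by
    rw [inner_self_eq_norm_sq_to_K, hv]; simp
  have e₁ := unit _ hη₁
  have e₂ := unit _ hη₂
  have f₁ := unit _ hξ₁
  have f₂ := unit _ hξ₂
  have pyth : ∀ (x y : H) (a b : ℂ), ‖x‖ = 1 → ‖y‖ = 1 → ⟪x, y⟫_ℂ = 0 →
      ‖a • x + b • y‖ ^ 2 = ‖a‖ ^ 2 + ‖b‖ ^ 2 := fun x y a b hx hy hxy => by
    have := norm_add_sq_eq_norm_sq_add_norm_sq_of_inner_eq_zero (𝕜 := ℂ) (a • x) (b • y)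
      (by rw [inner_smul_left, inner_smul_right, hxy]; simp)
    rw [norm_smul, norm_smul, hx, hy] at this
    nlinarith
  set T : B H := InnerProductSpace.rankOne ℂ (η₁ + η₂) ξ₁ +
    InnerProductSpace.rankOne ℂ (η₁ - η₂) ξ₂ with hT
  have hTv : ∀ v, T v = (⟪ξ₁, v⟫_ℂ + ⟪ξ₂, v⟫_ℂ) • η₁ + (⟪ξ₁, v⟫_ℂ - ⟪ξ₂, v⟫_ℂ) • η₂ := fun v => by
    change ⟪ξ₁, v⟫_ℂ • (η₁ + η₂) + ⟪ξ₂, v⟫_ℂ • (η₁ - η₂) = _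
    module
  have hTn : ‖T‖ ≤ √2 := by
    refine ContinuousLinearMap.opNorm_le_bound _ (by positivity) fun v => ?_
    refine le_of_sq_le_sq ?_ (by positivity)
    rw [hTv, pyth _ _ _ _ hη₁ hη₂ hη, mul_pow, Real.sq_sqrt zero_le_two]
    have h1 := parallelogram_law_with_norm ℂ ⟪ξ₁, v⟫_ℂ ⟪ξ₂, v⟫_ℂ
    have h2 : ‖⟪ξ₁, v⟫_ℂ‖ ^ 2 + ‖⟪ξ₂, v⟫_ℂ‖ ^ 2 ≤ ‖v‖ ^ 2 := by
      have ho : Orthonormal ℂ ![ξ₁, ξ₂] := by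
        refine ⟨fun i => by fin_cases i <;> simp [hξ₁, hξ₂], fun i j hij => ?_⟩
        fin_cases i <;> fin_cases j <;> simp_all
      simpa using ho.sum_inner_products_le (s := Finset.univ) v
    nlinarith
  set u := (2 : ℂ) • ξ₁ + (1 : ℂ) • ξ₂ with hu
  set w := (2 : ℂ) • η₁ + (1 : ℂ) • η₂ with hw
  have hun : ‖u‖ ^ 2 = 5 := by rw [hu, pyth _ _ _ _ hξ₁ hξ₂ hξ]; norm_num
  have hwn : ‖w‖ ^ 2 = 5 := by rw [hw, pyth _ _ _ _ hη₁ hη₂ hη]; norm_num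
  have hval : ⟪w, Φ T u⟫_ℂ = 8 := by
    rw [hw, hu]
    simp only [map_add, map_smul, inner_add_left, inner_add_right, inner_smul_left,
      inner_smul_right, h₁₁, h₁₂, h₂₁, h₂₂ T, hTv, e₁, e₂, f₁, f₂, hη, hη', hξ, hξ']
    simp only [map_ofNat, map_one]
    norm_num
  have h1 : ‖⟪w, Φ T u⟫_ℂ‖ ≤ ‖w‖ * (√2 * ‖u‖) := by
    refine (norm_inner_le_norm _ _).trans ?_
    gcongr
    refine (Φ T).le_of_opNorm_le ?_ u
    exact (Φ.le_of_opNorm_le hc T).trans (by simpa using hTn)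
  rw [hval] at h1
  have h2 : (8 : ℝ) ≤ ‖w‖ * (√2 * ‖u‖) := by simpa using h1
  have h3 : (8 : ℝ) ^ 2 ≤ (‖w‖ * (√2 * ‖u‖)) ^ 2 := pow_le_pow_left₀ (by norm_num) h2 2
  rw [mul_pow, mul_pow, hun, hwn, Real.sq_sqrt zero_le_two] at h3
  norm_num at h3

/-- A contractive Schur idempotent cannot act as the identity on exactly three corners of a
two by two block. -/
theorem IsSchurIdempotent.no_three_of_four (hD : IsMasa D) (h : IsSchurIdempotent D Φ)
    (hc : ‖Φ‖ ≤ 1) {ξ₁ ξ₂ η₁ η₂ : H} (hξ₁ : ξ₁ ≠ 0) (hξ₂ : ξ₂ ≠ 0) (hη₁ : η₁ ≠ 0) (hη₂ : η₂ ≠ 0)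
    (h₁₁ : Null (ContinuousLinearMap.id ℂ (B H) - Φ) ξ₁ η₁)
    (h₁₂ : Null (ContinuousLinearMap.id ℂ (B H) - Φ) ξ₁ η₂)
    (h₂₁ : Null (ContinuousLinearMap.id ℂ (B H) - Φ) ξ₂ η₁) (h₂₂ : Null Φ ξ₂ η₂) : False := by
  have hb := h.isBimoduleMap
  have hb' := h.compl.isBimoduleMap
  have hξ : ⟪ξ₁, ξ₂⟫_ℂ = 0 := by
    have := (hb.inv_nullL η₂).le_orthogonal_of_disjoint hD (isClosed_nullL _ _)
      (isClosed_nullL _ _) (hb'.inv_nullL η₂)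
      (fun v hv hv' => (eq_zero_or_eq_zero_of_null hv hv').resolve_right hη₂)
    exact Submodule.inner_right_of_mem_orthogonal (mem_nullL.2 h₁₂) (this (mem_nullL.2 h₂₂))
  have hη : ⟪η₁, η₂⟫_ℂ = 0 := by
    have := (hb.inv_nullR ξ₂).le_orthogonal_of_disjoint hD (isClosed_nullR _ _)
      (isClosed_nullR _ _) (hb'.inv_nullR ξ₂)
      (fun v hv hv' => (eq_zero_or_eq_zero_of_null hv hv').resolve_left hξ₂)
    exact Submodule.inner_right_of_mem_orthogonal (mem_nullR.2 h₂₁) (this (mem_nullR.2 h₂₂))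
  have smul : ∀ (Ψ : B H →L[ℂ] B H) (a b : ℂ) {ξ η : H}, Null Ψ ξ η → Null Ψ (a • ξ) (b • η) :=
    fun Ψ a b ξ η hn => (nullL Ψ _).smul_mem a ((nullR Ψ ξ).smul_mem b hn)
  refine no_three_of_four_of_unit hc (norm_smul_inv_norm (𝕜 := ℂ) hξ₁)
    (norm_smul_inv_norm (𝕜 := ℂ) hξ₂) (norm_smul_inv_norm (𝕜 := ℂ) hη₁)
    (norm_smul_inv_norm (𝕜 := ℂ) hη₂) ?_ ?_ (null_compl_iff.1 (smul _ _ _ h₁₁))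
    (null_compl_iff.1 (smul _ _ _ h₁₂)) (null_compl_iff.1 (smul _ _ _ h₂₁)) (smul _ _ _ h₂₂)
  · rw [inner_smul_left, inner_smul_right, hξ]; simp
  · rw [inner_smul_left, inner_smul_right, hη]; simp

end SchurHyper

namespace SchurHyper

variable {H : Type*} [NormedAddCommGroup H] [InnerProductSpace ℂ H]

section OrthogonalFamilies

variable {ι : Type*} {P Q : ι → Submodule ℂ H} [∀ i, (P i).HasOrthogonalProjection]
  [∀ i, (Q i).HasOrthogonalProjection]

theorem sum_norm_sq_starProjection_le (hP : Pairwise fun i j => P i ⟂ P j) (ξ : H) (s : Finset ι) :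
    ∑ i ∈ s, ‖(P i).starProjection ξ‖ ^ 2 ≤ ‖ξ‖ ^ 2 := by
  have h1 : ‖∑ i ∈ s, (P i).starProjection ξ‖ ^ 2 = ∑ i ∈ s, ‖(P i).starProjection ξ‖ ^ 2 :=
    (OrthogonalFamily.of_pairwise hP).norm_sum (fun i => (P i).orthogonalProjectionOnto ξ) s
  have h2 : RCLike.re ⟪∑ i ∈ s, (P i).starProjection ξ, ξ⟫_ℂ =
      ∑ i ∈ s, ‖(P i).starProjection ξ‖ ^ 2 := by
    rw [sum_inner, map_sum]
    exact Finset.sum_congr rfl fun i _ => (P i).re_inner_starProjection_eq_normSq ξ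
  have h3 := re_inner_le_norm (𝕜 := ℂ) (∑ i ∈ s, (P i).starProjection ξ) ξ
  rw [h2, ← h1] at h3
  rw [← h1]
  nlinarith [norm_nonneg (∑ i ∈ s, (P i).starProjection ξ), norm_nonneg ξ]

theorem norm_sum_le_of_orthogonal (hP : Pairwise fun i j => P i ⟂ P j)
    (hQ : Pairwise fun i j => Q i ⟂ Q j) {ξ η : H} {a : ℝ} (ha : 0 ≤ a) {c : ι → ℂ}
    (hc : ∀ i, ‖c i‖ ≤ a * (‖(P i).starProjection ξ‖ * ‖(Q i).starProjection η‖)) (s : Finset ι) :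
    ‖∑ i ∈ s, c i‖ ≤ a * (‖ξ‖ * ‖η‖) := by
  refine (norm_sum_le_of_le s fun i _ => hc i).trans ?_
  rw [← Finset.mul_sum]
  refine mul_le_mul_of_nonneg_left ((Real.sum_mul_le_sqrt_mul_sqrt s _ _).trans ?_) ha
  refine mul_le_mul ?_ ?_ (Real.sqrt_nonneg _) (norm_nonneg _)
  · exact (Real.sqrt_le_left (norm_nonneg _)).2 (sum_norm_sq_starProjection_le hP ξ s)
  · exact (Real.sqrt_le_left (norm_nonneg _)).2 (sum_norm_sq_starProjection_le hQ η s)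

theorem exists_hasSum_starProjection [CompleteSpace H] (hP : Pairwise fun i j => P i ⟂ P j)
    (ξ : H) : ∃ ζ, HasSum (fun i => (P i).starProjection ξ) ζ ∧ ∀ i, ξ - ζ ∈ (P i)ᗮ := by
  have hs : Summable fun i => (P i).starProjection ξ :=
    ((OrthogonalFamily.of_pairwise hP).summable_iff_norm_sq_summable
      fun i => (P i).orthogonalProjectionOnto ξ).2
      (summable_of_sum_le (fun i => by positivity) (sum_norm_sq_starProjection_le hP ξ))
  refine ⟨_, hs.hasSum, fun j => ?_⟩
  have h1 := hs.hasSum.mapL ((P j).starProjection)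
  have h2 := hasSum_single (f := fun i => (P j).starProjection ((P i).starProjection ξ)) j
    fun i hij => ((P j).starProjection_apply_eq_zero_iff).2
      (hP hij ((P i).starProjection_apply_mem ξ))
  rw [← (P j).starProjection_apply_eq_zero_iff, map_sub, h1.unique h2, sub_eq_zero,
    Submodule.starProjection_eq_self_iff.2 ((P j).starProjection_apply_mem ξ)]

end OrthogonalFamilies

variable [CompleteSpace H] {D : StarSubalgebra ℂ (B H)} {Φ : B H →L[ℂ] B H}

/-- A block of `Φ`: a rectangle on which `Φ` is the identity, and such that `Φ` vanishes on the
rest of its rows and columns. -/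
structure IsBlock (D : StarSubalgebra ℂ (B H)) (Φ : B H →L[ℂ] B H) (P Q : Submodule ℂ H) :
    Prop where
  closed_left : IsClosed (P : Set H)
  closed_right : IsClosed (Q : Set H)
  inv_left : Inv D P
  inv_right : Inv D Q
  ne_bot_left : ∃ v ∈ P, v ≠ 0
  ne_bot_right : ∃ v ∈ Q, v ≠ 0
  good : ∀ ξ ∈ P, ∀ η ∈ Q, Null (ContinuousLinearMap.id ℂ (B H) - Φ) ξ η
  null_left : ∀ ξ ∈ Pᗮ, ∀ η ∈ Q, Null Φ ξ η
  null_right : ∀ ξ ∈ P, ∀ η ∈ Qᗮ, Null Φ ξ η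

theorem IsSchurIdempotent.exists_isBlock (hD : IsMasa D) (h : IsSchurIdempotent D Φ)
    (hc : ‖Φ‖ ≤ 1) {ξ₀ η₀ : H} (hξ₀ : ξ₀ ≠ 0) (hη₀ : η₀ ≠ 0)
    (hg : Null (ContinuousLinearMap.id ℂ (B H) - Φ) ξ₀ η₀) :
    ∃ P Q, IsBlock D Φ P Q ∧ ξ₀ ∈ P := by
  set Ψ := ContinuousLinearMap.id ℂ (B H) - Φ with hΨ
  have hb := h.compl.isBimoduleMap
  rw [← hΨ] at hb
  set P := nullL Ψ η₀ with hP
  set Q := nullR Ψ ξ₀ with hQ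
  have hPc : IsClosed (P : Set H) := isClosed_nullL _ _
  have hQc : IsClosed (Q : Set H) := isClosed_nullR _ _
  have hPD : Inv D P := hb.inv_nullL _
  have hQD : Inv D Q := hb.inv_nullR _
  have hξP : ξ₀ ∈ P := hg
  have hηQ : η₀ ∈ Q := hg
  refine ⟨P, Q, ⟨hPc, hQc, hPD, hQD, ⟨ξ₀, hξP, hξ₀⟩, ⟨η₀, hηQ, hη₀⟩, fun ξ hξ η hη => ?_,
    fun ξ hξ η hη => ?_, fun ξ hξ η hη => ?_⟩, hξP⟩
  · by_contra hn
    obtain ⟨x, hx, k, hk, hx0, hk0, hxk⟩ := h.exists_null hD hPc hPD hQc hQD hξ hη hn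
    exact h.no_three_of_four hD hc hξ₀ hx0 hη₀ hk0 hg hk hx hxk
  · by_contra hn
    obtain ⟨x, hx, k, hk, hx0, hk0, hxk⟩ :=
      h.exists_good hD P.isClosed_orthogonal hPD.orthogonal hQc hQD hξ hη hn
    obtain ⟨x', hx', k', hk', hx0', hk0', hxk'⟩ := h.exists_null hD
      (P.isClosed_orthogonal.inter (isClosed_nullL Ψ k)) (hPD.orthogonal.inf (hb.inv_nullL k))
      hQc hQD ⟨hx, hxk⟩ hηQ fun h0 => hx0 (eq_zero_of_mem_orthogonal (N := P) h0 hx)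
    exact h.no_three_of_four hD hc hξ₀ hx0' hk0 hk0' hk hk' hx'.2 hxk'
  · by_contra hn
    obtain ⟨x, hx, k, hk, hx0, hk0, hxk⟩ :=
      h.exists_good hD hPc hPD Q.isClosed_orthogonal hQD.orthogonal hξ hη hn
    obtain ⟨x', hx', k', hk', hx0', hk0', hxk'⟩ := h.exists_null hD hPc hPD
      (Q.isClosed_orthogonal.inter (isClosed_nullR Ψ x)) (hQD.orthogonal.inf (hb.inv_nullR x))
      hξP ⟨hk, hxk⟩ fun h0 => hk0 (eq_zero_of_mem_orthogonal (N := Q) h0 hk)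
    exact h.no_three_of_four hD hc hx0 hx0' hη₀ hk0' hx hk'.2 hx' hxk'

namespace IsBlock

variable {P Q P' Q' : Submodule ℂ H}

theorem right_le (hB : IsBlock D Φ P Q) (hB' : IsBlock D Φ P' Q') {v : H} (hv : v ∈ P)
    (hv' : v ∈ P') (hv0 : v ≠ 0) : Q' ≤ Q := fun η hη => by
  have : CompleteSpace Q := hB.closed_right.completeSpace_coe
  have h1 := hB.null_right v hv _ (Q.sub_starProjection_mem_orthogonal η)
  have h2 : η - Q.starProjection η ∈ nullR (ContinuousLinearMap.id ℂ (B H) - Φ) v :=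
    sub_mem (mem_nullR.2 (hB'.good v hv' η hη))
      (mem_nullR.2 (hB.good v hv _ (Q.starProjection_apply_mem η)))
  rw [sub_eq_zero.1 ((eq_zero_or_eq_zero_of_null h1 h2).resolve_left hv0)]
  exact Q.starProjection_apply_mem η

theorem left_le (hB : IsBlock D Φ P Q) (hB' : IsBlock D Φ P' Q') {v : H} (hv : v ∈ Q)
    (hv' : v ∈ Q') (hv0 : v ≠ 0) : P' ≤ P := fun ξ hξ => by
  have : CompleteSpace P := hB.closed_left.completeSpace_coe
  have h1 := hB.null_left _ (P.sub_starProjection_mem_orthogonal ξ) v hv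
  have h2 : ξ - P.starProjection ξ ∈ nullL (ContinuousLinearMap.id ℂ (B H) - Φ) v :=
    sub_mem (mem_nullL.2 (hB'.good ξ hξ v hv'))
      (mem_nullL.2 (hB.good _ (P.starProjection_apply_mem ξ) v hv))
  rw [sub_eq_zero.1 ((eq_zero_or_eq_zero_of_null h1 h2).resolve_right hv0)]
  exact P.starProjection_apply_mem ξ

theorem eq_of_mem_left (hB : IsBlock D Φ P Q) (hB' : IsBlock D Φ P' Q') {v : H} (hv : v ∈ P)
    (hv' : v ∈ P') (hv0 : v ≠ 0) : P = P' ∧ Q = Q' := by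
  have h1 : Q = Q' := le_antisymm (hB'.right_le hB hv' hv hv0) (hB.right_le hB' hv hv' hv0)
  obtain ⟨w, hw, hw0⟩ := hB.ne_bot_right
  have hw' : w ∈ Q' := h1 ▸ hw
  exact ⟨le_antisymm (hB'.left_le hB hw' hw hw0) (hB.left_le hB' hw hw' hw0), h1⟩

theorem eq_of_mem_right (hB : IsBlock D Φ P Q) (hB' : IsBlock D Φ P' Q') {v : H} (hv : v ∈ Q)
    (hv' : v ∈ Q') (hv0 : v ≠ 0) : P = P' ∧ Q = Q' := by
  have h1 : P = P' := le_antisymm (hB'.left_le hB hv' hv hv0) (hB.left_le hB' hv hv' hv0)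
  obtain ⟨w, hw, hw0⟩ := hB.ne_bot_left
  exact hB.eq_of_mem_left hB' hw (h1 ▸ hw) hw0

end IsBlock

/-- A contractive Schur idempotent is the block diagonal truncation along two orthogonal families
of invariant subspaces. -/
theorem IsSchurIdempotent.exists_blocks (hD : IsMasa D) (h : IsSchurIdempotent D Φ)
    (hc : ‖Φ‖ ≤ 1) :
    ∃ I : Set (Submodule ℂ H × Submodule ℂ H), (∀ i : I, IsBlock D Φ i.1.1 i.1.2) ∧
      (Pairwise fun i j : I => i.1.1 ⟂ j.1.1) ∧ (Pairwise fun i j : I => i.1.2 ⟂ j.1.2) ∧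
      ∀ ξ, (∀ i : I, ξ ∈ (i.1.1)ᗮ) → ∀ η, Null Φ ξ η := by
  refine ⟨{R | IsBlock D Φ R.1 R.2}, fun i => i.2, fun i j hij => ?_, fun i j hij => ?_, fun ξ hξ η => ?_⟩
  · refine i.2.inv_left.le_orthogonal_of_disjoint hD i.2.closed_left j.2.closed_left j.2.inv_left
      fun v hv hv' => ?_
    by_contra hv0
    have := i.2.eq_of_mem_left j.2 hv hv' hv0
    exact hij (Subtype.ext (Prod.ext this.1 this.2))
  · refine i.2.inv_right.le_orthogonal_of_disjoint hD i.2.closed_right j.2.closed_right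
      j.2.inv_right fun v hv hv' => ?_
    by_contra hv0
    have := i.2.eq_of_mem_right j.2 hv hv' hv0
    exact hij (Subtype.ext (Prod.ext this.1 this.2))
  · by_contra hn
    set R : Submodule ℂ H :=
      ⨅ i : {R : Submodule ℂ H × Submodule ℂ H | IsBlock D Φ R.1 R.2}, (i.1.1)ᗮ with hR
    have hRc : IsClosed (R : Set H) := by
      rw [hR, Submodule.coe_iInf]
      exact isClosed_iInter fun i => (i.1.1).isClosed_orthogonal
    have hRD : Inv D R := fun A hA v hv => (Submodule.mem_iInf _).2 fun i =>
      i.2.inv_left.orthogonal A hA v ((Submodule.mem_iInf _).1 hv i)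
    obtain ⟨x, hx, k, -, hx0, hk0, hxk⟩ := h.exists_good hD hRc hRD
      (Q := ⊤) isClosed_univ (fun _ _ _ _ => Submodule.mem_top) ((Submodule.mem_iInf _).2 hξ)
      (Submodule.mem_top (x := η)) hn
    obtain ⟨P, Q, hB, hxP⟩ := h.exists_isBlock hD hc hx0 hk0 hxk
    exact hx0 (eq_zero_of_mem_orthogonal hxP ((Submodule.mem_iInf _).1 hx ⟨(P, Q), hB⟩))

end SchurHyper

namespace SchurHyper

variable {H : Type*} [NormedAddCommGroup H] [InnerProductSpace ℂ H]

theorem bddBelow_range_norm_sub (T : B H) (X : Set (B H)) (ξ : H) :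
    BddBelow (Set.range fun S : X => ‖T ξ - S.1 ξ‖) :=
  ⟨0, by rintro _ ⟨S, rfl⟩; exact norm_nonneg _⟩

theorem arveson_nonneg (T : B H) (X : Set (B H)) : 0 ≤ arveson T X :=
  Real.iSup_nonneg fun _ => Real.iInf_nonneg fun _ => norm_nonneg _

/-- Matrix coefficients of `T` along pairs annihilated by `X` are bounded by the Arveson distance
to `X`. -/
theorem norm_inner_le_arveson {X : Set (B H)} (h0 : 0 ∈ X) (T : B H) {x y : H}
    (h : ∀ S ∈ X, ⟪y, S x⟫_ℂ = 0) : ‖⟪y, T x⟫_ℂ‖ ≤ arveson T X * (‖x‖ * ‖y‖) := by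
  rcases eq_or_ne x 0 with rfl | hx
  · simp
  have hx' : 0 < ‖x‖ := norm_pos_iff.2 hx
  set e : H := ((‖x‖ : ℂ)⁻¹) • x with he
  have hen : ‖e‖ = 1 := norm_smul_inv_norm hx
  have hxe : x = (‖x‖ : ℂ) • e := by
    rw [he, smul_inv_smul₀ (by exact_mod_cast hx'.ne')]
  have : Nonempty X := ⟨⟨0, h0⟩⟩
  have hbdd : BddAbove (Set.range fun ξ : {ξ : H // ‖ξ‖ = 1} => ⨅ S : X, ‖T ξ.1 - S.1 ξ.1‖) := by
    refine ⟨‖T‖, ?_⟩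
    rintro _ ⟨ξ, rfl⟩
    refine (ciInf_le (bddBelow_range_norm_sub T X ξ.1) ⟨0, h0⟩).trans ?_
    simpa [ξ.2] using T.le_opNorm ξ.1
  have h1 : ⨅ S : X, ‖T e - S.1 e‖ ≤ arveson T X := le_ciSup hbdd ⟨e, hen⟩
  rcases eq_or_ne y 0 with rfl | hy
  · simp
  have hy' : 0 < ‖y‖ := norm_pos_iff.2 hy
  have h2 : ‖⟪y, T x⟫_ℂ‖ / (‖x‖ * ‖y‖) ≤ ⨅ S : X, ‖T e - S.1 e‖ := by
    refine le_ciInf fun S => (div_le_iff₀ (by positivity)).2 ?_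
    have h3 : ⟪y, T x⟫_ℂ = ⟪y, T x - S.1 x⟫_ℂ := by rw [inner_sub_right, h _ S.2, sub_zero]
    have h4 : ‖T x - S.1 x‖ = ‖x‖ * ‖T e - S.1 e‖ := by
      have h5 : T x - S.1 x = (‖x‖ : ℂ) • (T e - S.1 e) := by
        rw [smul_sub, ← ContinuousLinearMap.map_smul, ← ContinuousLinearMap.map_smul, ← hxe]
      rw [h5, norm_smul]
      simp
    have h5 := norm_inner_le_norm (𝕜 := ℂ) y (T x - S.1 x)
    rw [h3]
    rw [h4] at h5
    linarith
  exact (div_le_iff₀ (by positivity)).1 (h2.trans h1)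

variable [CompleteSpace H]

/-- The distance from `T ξ` to `U ξ` is controlled by the orthogonal complement of `U ξ`. -/
theorem iInf_norm_sub_le (T : B H) (U : Submodule ℂ (B H)) {ξ : H} {a : ℝ}
    (h : ∀ η, (∀ S ∈ U, ⟪η, S ξ⟫_ℂ = 0) → ‖⟪η, T ξ⟫_ℂ‖ ≤ a * ‖η‖) (ha : 0 ≤ a) :
    ⨅ S : (U : Set (B H)), ‖T ξ - S.1 ξ‖ ≤ a := by
  set N := (U.map (ContinuousLinearMap.apply ℂ H ξ).toLinearMap).topologicalClosure with hN
  have : CompleteSpace N := (Submodule.isClosed_topologicalClosure _).completeSpace_coe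
  set v := T ξ with hv
  set η := v - N.starProjection v with hη
  have hηN : η ∈ Nᗮ := N.sub_starProjection_mem_orthogonal v
  have h1 : ‖⟪η, v⟫_ℂ‖ ≤ a * ‖η‖ := by
    refine h η fun S hS => ?_
    exact N.inner_left_of_mem_orthogonal
      (Submodule.le_topologicalClosure _ (Submodule.mem_map_of_mem hS)) hηN
  have h2 : ⟪η, v⟫_ℂ = ⟪η, η⟫_ℂ := by
    conv_rhs => rw [hη]
    rw [inner_sub_right, N.inner_left_of_mem_orthogonal (N.starProjection_apply_mem v) hηN,
      sub_zero]
  have h3 : ‖η‖ ≤ a := by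
    rw [h2, inner_self_eq_norm_sq_to_K, norm_pow] at h1
    simp only [Complex.coe_algebraMap, Complex.norm_real, norm_norm] at h1
    by_contra! hlt
    nlinarith
  refine le_of_forall_pos_le_add fun ε hε => ?_
  obtain ⟨_, ⟨S, hS, rfl⟩, hd⟩ := Metric.mem_closure_iff.1 (N.starProjection_apply_mem v) ε hε
  rw [dist_eq_norm] at hd
  refine (ciInf_le (bddBelow_range_norm_sub T _ ξ) ⟨S, hS⟩).trans ?_
  have h4 : v - S ξ = η + (N.starProjection v - S ξ) := by rw [hη]; abel
  change ‖v - S ξ‖ ≤ _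
  rw [h4]
  exact (norm_add_le _ _).trans (add_le_add h3 hd.le)

variable {D : StarSubalgebra ℂ (B H)} {Φ : B H →L[ℂ] B H}

theorem IsSchurIdempotent.norm_inner_le (hD : IsMasa D) (h : IsSchurIdempotent D Φ)
    (hc : ‖Φ‖ ≤ 1) {U : Submodule ℂ (B H)} (hU : IsBimodule D U) (T : B H) {ξ η : H}
    (hη : ∀ S ∈ U, ⟪η, S ξ⟫_ℂ = 0) :
    ‖⟪η, Φ T ξ⟫_ℂ‖ ≤ arveson T
      ((U : Set (B H)) + Set.range ⇑(ContinuousLinearMap.id ℂ (B H) - Φ)) * (‖ξ‖ * ‖η‖) := by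
  set W := (U : Set (B H)) + Set.range ⇑(ContinuousLinearMap.id ℂ (B H) - Φ) with hW
  have h0 : 0 ∈ W := ⟨0, U.zero_mem, 0, ⟨0, map_zero _⟩, add_zero _⟩
  obtain ⟨I, hI, hP, hQ, hnull⟩ := h.exists_blocks hD hc
  have (i : I) : CompleteSpace i.1.1 := (hI i).closed_left.completeSpace_coe
  have (i : I) : CompleteSpace i.1.2 := (hI i).closed_right.completeSpace_coe
  obtain ⟨ζ, hζ, hζP⟩ := exists_hasSum_starProjection hP ξ
  have hterm (i : I) : ‖⟪η, Φ T (i.1.1.starProjection ξ)⟫_ℂ‖ ≤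
      arveson T W * (‖i.1.1.starProjection ξ‖ * ‖i.1.2.starProjection η‖) := by
    set x := i.1.1.starProjection ξ with hx
    set y := i.1.2.starProjection η with hy
    have hxP : x ∈ i.1.1 := Submodule.starProjection_apply_mem _ _
    have hyQ : y ∈ i.1.2 := Submodule.starProjection_apply_mem _ _
    have h1 : ⟪η, Φ T x⟫_ℂ = ⟪y, Φ T x⟫_ℂ := by
      rw [← sub_eq_zero, ← inner_sub_left]
      exact (hI i).null_right x hxP _ (Submodule.sub_starProjection_mem_orthogonal η) T
    have hg := (hI i).good x hxP y hyQ
    rw [h1, null_compl_iff.1 hg]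
    refine norm_inner_le_arveson h0 T ?_
    rintro _ ⟨S, hS, _, ⟨R, rfl⟩, rfl⟩
    change ⟪y, S x + (ContinuousLinearMap.id ℂ (B H) - Φ) R x⟫_ℂ = 0
    rw [inner_add_right, hg R, add_zero, hy, Submodule.inner_starProjection_left_eq_right]
    exact hη _ (hU _ ((hI i).inv_right.starProjection_mem hD) _
      ((hI i).inv_left.starProjection_mem hD) S hS)
  have hlim : HasSum (fun i : I => ⟪η, Φ T (i.1.1.starProjection ξ)⟫_ℂ) ⟪η, Φ T ζ⟫_ℂ :=
    (hζ.mapL (Φ T)).mapL (innerSL ℂ η)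
  have hval : ⟪η, Φ T ξ⟫_ℂ = ⟪η, Φ T ζ⟫_ℂ := by
    have := hnull _ hζP η T
    rwa [map_sub, inner_sub_right, sub_eq_zero] at this
  rw [hval]
  exact le_of_tendsto hlim.norm (Filter.Eventually.of_forall
    (norm_sum_le_of_orthogonal hP hQ (arveson_nonneg _ _) hterm))

theorem IsSchurIdempotent.arveson_apply_le (hD : IsMasa D) (h : IsSchurIdempotent D Φ)
    (hc : ‖Φ‖ ≤ 1) {U : Submodule ℂ (B H)} (hU : IsBimodule D U) (T : B H) :
    arveson (Φ T) (U : Set (B H)) ≤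
      arveson T ((U : Set (B H)) + Set.range ⇑(ContinuousLinearMap.id ℂ (B H) - Φ)) := by
  refine Real.iSup_le (fun ξ => ?_) (arveson_nonneg _ _)
  refine iInf_norm_sub_le (Φ T) U (fun η hη => ?_) (arveson_nonneg _ _)
  simpa [ξ.2] using h.norm_inner_le hD hc hU T hη

omit [CompleteSpace H] in
theorem infDist_add_range_le (U : Submodule ℂ (B H)) (T : B H) :
    Metric.infDist T ((U : Set (B H)) + Set.range ⇑(ContinuousLinearMap.id ℂ (B H) - Φ)) ≤
      Metric.infDist (Φ T) (U : Set (B H)) := by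
  refine (Metric.le_infDist ⟨0, U.zero_mem⟩).2 fun S hS => ?_
  have h1 : S + (T - Φ T) ∈
      (U : Set (B H)) + Set.range ⇑(ContinuousLinearMap.id ℂ (B H) - Φ) :=
    Set.add_mem_add hS ⟨T, rfl⟩
  refine (Metric.infDist_le_dist_of_mem h1).trans_eq ?_
  rw [dist_eq_norm, dist_eq_norm]
  congr 1
  abel

theorem IsSchurIdempotent.hyperSet_subset (hD : IsMasa D) (h : IsSchurIdempotent D Φ)
    (hc : ‖Φ‖ ≤ 1) {U : Submodule ℂ (B H)} (hU : IsBimodule D U) :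
    hyperSet (U : Set (B H)) ⊆
      hyperSet ((U : Set (B H)) + Set.range ⇑(ContinuousLinearMap.id ℂ (B H) - Φ)) :=
  fun _ hk => ⟨hk.1, fun T => (infDist_add_range_le U T).trans ((hk.2 (Φ T)).trans
    (mul_le_mul_of_nonneg_left (h.arveson_apply_le hD hc hU T) hk.1.le))⟩

end SchurHyper

/-- if `Φ` is a contractive Schur idempotent and `U` is a
hyperreflexive weak* closed masa-bimodule, then `W = U + ran (id − Φ)` is
hyperreflexive with `k(W) ≤ k(U)`. -/
theorem stmt10 {H : Type*} [NormedAddCommGroup H] [InnerProductSpace ℂ H] [CompleteSpace H]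
    [TopologicalSpace.SeparableSpace H]
    (D : StarSubalgebra ℂ (B H)) (hD : IsMasa D)
    (Φ : B H →L[ℂ] B H) (hΦ : IsSchurIdempotent D Φ) (hc : ‖Φ‖ ≤ 1)
    (U : Submodule ℂ (B H)) (hUbim : IsBimodule D U)
    (hUcl : WStarClosed H (U : Set (B H))) (hUhr : Hyperreflexive (U : Set (B H))) :
    Hyperreflexive
      ((U : Set (B H)) + Set.range ⇑(ContinuousLinearMap.id ℂ (B H) - Φ)) ∧
    hyperConst ((U : Set (B H)) + Set.range ⇑(ContinuousLinearMap.id ℂ (B H) - Φ)) ≤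
      hyperConst (U : Set (B H)) := by
  have hsub := hΦ.hyperSet_subset hD hc hUbim
  exact ⟨hUhr.mono hsub, csInf_le_csInf ⟨0, fun _ hk => hk.1.le⟩ hUhr hsub⟩
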